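/- Every triangulation of a 3-dimensional m-prism (in any coordinatization) has at least 2m - 5 + ⌈m/2⌉ tetrahedra, and this bound is attained; hence the minimal triangulation of an m-prism has size 2m - 5 + ⌈m/2⌉. -/

import Mathlib

open Set MeasureTheory
open scoped Classical

noncomputable section

abbrev Pt3 := Fin 3 → ℝ

/-- A (geometric) tetrahedron: 4 affinely independent points. -/
def IsTet (σ : Finset Pt3) : Prop :=
  σ.card = 4 ∧ AffineIndependent ℝ (fun p : (σ : Set Pt3) => (p : Pt3))

/-- A dissection of the convex polytope `conv V` using only vertices in `V`:
tetrahedra with pairwise disjoint interiors covering the polytope. -/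
def IsDissection (V : Finset Pt3) (D : Finset (Finset Pt3)) : Prop :=
  (∀ σ ∈ D, IsTet σ ∧ (σ : Set Pt3) ⊆ (V : Set Pt3)) ∧
  (∀ σ ∈ D, ∀ τ ∈ D, σ ≠ τ →
    interior (convexHull ℝ (σ : Set Pt3)) ∩ interior (convexHull ℝ (τ : Set Pt3)) = ∅) ∧
  (⋃ σ ∈ D, convexHull ℝ (σ : Set Pt3)) = convexHull ℝ (V : Set Pt3)

/-- A triangulation: a dissection in which any two tetrahedra meet in a common
(possibly empty) face. -/
def IsTriangulation (V : Finset Pt3) (D : Finset (Finset Pt3)) : Prop :=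
  IsDissection V D ∧
  ∀ σ ∈ D, ∀ τ ∈ D,
    convexHull ℝ (σ : Set Pt3) ∩ convexHull ℝ (τ : Set Pt3)
      = convexHull ℝ ((σ ∩ τ : Finset Pt3) : Set Pt3)

/-- `ψ` realizes a combinatorial equivalence between the polytopes with vertex
sets `A` and `V`: it maps the vertices of `conv A` bijectively onto those of
`conv V`, inducing an isomorphism of face lattices (faces being encoded as
extreme subsets spanned by vertex sets). -/
def CombEquiv (A V : Finset Pt3) (ψ : Pt3 → Pt3) : Prop :=
  Set.BijOn ψ (A : Set Pt3) (V : Set Pt3) ∧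
    ∀ S ⊆ (A : Set Pt3),
      (IsExtreme ℝ (convexHull ℝ (A : Set Pt3)) (convexHull ℝ S) ↔
       IsExtreme ℝ (convexHull ℝ (V : Set Pt3)) (convexHull ℝ (ψ '' S)))

/-- The bottom cap of the standard `m`-prism / `m`-antiprism: the vertices of a
regular `m`-gon at height `0`. -/
def stdBot (m : ℕ) : Finset Pt3 :=
  (Finset.univ : Finset (Fin m)).image
    (fun k => ![Real.cos (2 * Real.pi * k.1 / m), Real.sin (2 * Real.pi * k.1 / m), 0])

/-- The top cap of the standard `m`-prism: the same regular `m`-gon at height `1`. -/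
def stdPrismTop (m : ℕ) : Finset Pt3 :=
  (Finset.univ : Finset (Fin m)).image
    (fun k => ![Real.cos (2 * Real.pi * k.1 / m), Real.sin (2 * Real.pi * k.1 / m), 1])

/-- The top cap of the standard `m`-antiprism: the regular `m`-gon at height `1`,
rotated by half a step. -/
def stdAntiTop (m : ℕ) : Finset Pt3 :=
  (Finset.univ : Finset (Fin m)).image
    (fun k => ![Real.cos (Real.pi * (2 * k.1 + 1) / m), Real.sin (Real.pi * (2 * k.1 + 1) / m), 1])


abbrev cv (S : Set Pt3) : Set Pt3 := convexHull ℝ S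

theorem ext_inter {K B F : Set Pt3} (hB : IsExtreme ℝ K B) (hK : Convex ℝ K) 
    (hF : F ⊆ K) {z : Pt3} (hz : z ∈ cv F) (hzB : z ∈ B) : z ∈ cv (F ∩ B) := by
  have key : cv F ⊆ {x | x ∈ K ∧ (x ∈ B → x ∈ cv (F ∩ B))} := by
    apply convexHull_min
    · intro x hx
      exact ⟨hF hx, fun h => subset_convexHull ℝ _ ⟨hx, h⟩⟩
    · rw [convex_iff_openSegment_subset]
      rintro x ⟨hx1, hx2⟩ y ⟨hy1, hy2⟩ w hw
      refine ⟨hK.openSegment_subset hx1 hy1 hw, fun hwB => ?_⟩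
      exact (convex_convexHull ℝ _).openSegment_subset
        (hx2 (hB.left_mem_of_mem_openSegment hx1 hy1 hwB hw))
        (hy2 (hB.right_mem_of_mem_openSegment hx1 hy1 hwB hw)) hw
  exact (key hz).2 hzB

theorem aff_comb (f : Pt3 →ᵃ[ℝ] ℝ) {a b : ℝ} (h : a + b = 1) (x y : Pt3) :
    f (a • x + b • y) = a * f x + b * f y := by
  have := Convex.combo_affine_apply (f := f) (x := x) (y := y) h
  simpa using this

theorem conv_le {f : Pt3 →ᵃ[ℝ] ℝ} {c : ℝ} {V : Set Pt3} (h : ∀ x ∈ V, f x ≤ c) :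
    ∀ x ∈ cv V, f x ≤ c := by
  have : cv V ⊆ {x | f x ≤ c} := by
    apply convexHull_min h
    intro x (hx : f x ≤ c) y (hy : f y ≤ c) a b ha hb hab
    change f (a • x + b • y) ≤ c
    rw [aff_comb f hab]
    have hb' : b = 1 - a := by linarith
    subst hb'
    nlinarith
  exact this

theorem conv_ge {f : Pt3 →ᵃ[ℝ] ℝ} {c : ℝ} {V : Set Pt3} (h : ∀ x ∈ V, c ≤ f x) :
    ∀ x ∈ cv V, c ≤ f x := by
  have : cv V ⊆ {x | c ≤ f x} := by
    apply convexHull_min h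
    intro x (hx : c ≤ f x) y (hy : c ≤ f y) a b ha hb hab
    change c ≤ f (a • x + b • y)
    rw [aff_comb f hab]
    have hb' : b = 1 - a := by linarith
    subst hb'
    nlinarith
  exact this

theorem func_ext0 {f : Pt3 →ᵃ[ℝ] ℝ} {c : ℝ} {V : Set Pt3} (h : ∀ x ∈ V, f x ≤ c) :
    IsExtreme ℝ (cv V) {x | x ∈ cv V ∧ f x = c} := by
  refine ⟨fun x hx => hx.1, ?_⟩
  rintro x hx y hy z ⟨hz, hfz⟩ ⟨a, b, ha, hb, hab, rfl⟩
  refine ⟨hx, ?_⟩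
  rw [aff_comb f hab] at hfz
  have h1 := conv_le h x hx
  have h2 := conv_le h y hy
  by_contra hne
  have h3 : f x < c := lt_of_le_of_ne h1 hne
  have : b = 1 - a := by linarith
  subst this
  nlinarith

theorem func_conv {f : Pt3 →ᵃ[ℝ] ℝ} {c : ℝ} {V : Set Pt3} (h : ∀ x ∈ V, f x ≤ c) :
    {x | x ∈ cv V ∧ f x = c} = cv {x | x ∈ V ∧ f x = c} := by
  apply Subset.antisymm
  · rintro z ⟨hz, hf⟩
    have := ext_inter (func_ext0 h) (convex_convexHull ℝ _) (subset_convexHull ℝ V) hz ⟨hz, hf⟩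
    refine convexHull_mono ?_ this
    rintro x ⟨hx, hx2⟩
    exact ⟨hx, hx2.2⟩
  · intro z hz
    refine ⟨convexHull_mono (fun x hx => hx.1) hz, le_antisymm ?_ ?_⟩
    · exact conv_le (fun x hx => hx.2.le) z hz
    · exact conv_ge (fun x hx => hx.2.ge) z hz

theorem func_ext {f : Pt3 →ᵃ[ℝ] ℝ} {c : ℝ} {V : Set Pt3} (h : ∀ x ∈ V, f x ≤ c) :
    IsExtreme ℝ (cv V) (cv {x | x ∈ V ∧ f x = c}) := by
  rw [← func_conv h]; exact func_ext0 h

theorem relint_pt {S : Set Pt3} (hS : S.Nonempty) :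
    ∃ g ∈ cv S, ∀ y ∈ affineSpan ℝ S, ∃ e : ℝ, 0 < e ∧ g + e • (g - y) ∈ cv S := by
  obtain ⟨g, hg⟩ := Set.Nonempty.intrinsicInterior (convex_convexHull ℝ S) (hS.convexHull (𝕜 := ℝ))
  refine ⟨g, intrinsicInterior_subset hg, fun y hy => ?_⟩
  rw [mem_intrinsicInterior] at hg
  obtain ⟨g', hg', rfl⟩ := hg
  have hy' : y ∈ affineSpan ℝ (convexHull ℝ S) := by rwa [affineSpan_convexHull]
  have hmem : ∀ t : ℝ, (g' : Pt3) + t • ((g' : Pt3) - y) ∈ affineSpan ℝ (convexHull ℝ S) := by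
    intro t
    have := AffineMap.lineMap_mem (-t) g'.2 hy'
    convert this using 1
    rw [AffineMap.lineMap_apply]
    simp only [vsub_eq_sub, vadd_eq_add]
    module
  let φ : ℝ → affineSpan ℝ (convexHull ℝ S) := fun t => ⟨_, hmem t⟩
  have hφ : Continuous φ := by
    apply Continuous.subtype_mk
    fun_prop
  have h0 : φ 0 = g' := by
    apply Subtype.ext; simp [φ]
  have hn : φ ⁻¹' (interior ((↑) ⁻¹' convexHull ℝ S)) ∈ nhds (0 : ℝ) := by
    apply hφ.continuousAt.preimage_mem_nhds
    rw [h0]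
    exact isOpen_interior.mem_nhds hg'
  obtain ⟨e, he, hball⟩ := Metric.mem_nhds_iff.1 hn
  refine ⟨e / 2, by positivity, ?_⟩
  have := hball (show e / 2 ∈ Metric.ball (0 : ℝ) e by
    simp [abs_of_pos he]; linarith)
  exact interior_subset (s := (Subtype.val ⁻¹' convexHull ℝ S)) this

theorem span_face {K S : Set Pt3} (hE : IsExtreme ℝ K (cv S)) (hS : S.Nonempty) {x : Pt3}
    (hx : x ∈ K) (hxs : x ∈ affineSpan ℝ S) : x ∈ cv S := by
  obtain ⟨g, hg, h⟩ := relint_pt hS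
  obtain ⟨e, he, h2⟩ := h x hxs
  refine hE.left_mem_of_mem_openSegment hx (hE.subset h2) hg ?_
  refine ⟨e / (1 + e), 1 / (1 + e), by positivity, by positivity, by field_simp; ring, ?_⟩
  have : (1 + e) ≠ 0 := by positivity
  ext i
  simp
  field_simp
  ring

theorem ext_interior {K B : Set Pt3} (hE : IsExtreme ℝ K B) {z : Pt3} (hz : z ∈ B)
    (hzi : z ∈ interior K) : K ⊆ B := by
  intro x hx
  have hc : Continuous (fun t : ℝ => z + t • (z - x)) := by fun_prop
  have hn : (fun t : ℝ => z + t • (z - x)) ⁻¹' (interior K) ∈ nhds (0 : ℝ) := by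
    apply hc.continuousAt.preimage_mem_nhds
    simpa using isOpen_interior.mem_nhds hzi
  obtain ⟨e, he, hball⟩ := Metric.mem_nhds_iff.1 hn
  have := hball (show e / 2 ∈ Metric.ball (0 : ℝ) e by
    simp [abs_of_pos he]; linarith)
  have h2 : z + (e/2) • (z - x) ∈ K := interior_subset this
  refine hE.left_mem_of_mem_openSegment hx h2 hz ?_
  refine ⟨(e/2) / (1 + e/2), 1 / (1 + e/2), by positivity, by positivity, by field_simp; ring, ?_⟩
  have : (1 + e/2) ≠ 0 := by positivity
  ext i
  simp
  field_simp
  ring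

theorem supp_pt {K : Set Pt3} (hK : Convex ℝ K) (hi : (interior K).Nonempty) {y : Pt3}
    (hy : y ∉ interior K) : ∃ f : Pt3 →ᵃ[ℝ] ℝ, (∀ x ∈ K, f x ≤ f y) ∧ ∃ x ∈ K, f x < f y := by
  obtain ⟨f, hf⟩ := geometric_hahn_banach_open_point hK.interior isOpen_interior hy
  refine ⟨f.toLinearMap.toAffineMap, ?_, ?_⟩
  · intro x hx
    have h1 : x ∈ closure (interior K) := by
      rw [hK.closure_interior_eq_closure_of_nonempty_interior hi]; exact subset_closure hx
    have h2 : closure (interior K) ⊆ {x | f x ≤ f y} := by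
      apply closure_minimal
      · intro z hz; exact (hf z hz).le
      · exact isClosed_le f.continuous continuous_const
    exact h2 h1
  · obtain ⟨x, hx⟩ := hi
    exact ⟨x, interior_subset hx, hf x hx⟩

theorem supp_face {K S : Set Pt3} (hK : Convex ℝ K) (hi : (interior K).Nonempty)
    (hE : IsExtreme ℝ K (cv S)) (hS : S.Nonempty) (hne : ¬ K ⊆ cv S) :
    ∃ (f : Pt3 →ᵃ[ℝ] ℝ) (c : ℝ), (∀ x ∈ K, f x ≤ c) ∧ (∃ x ∈ K, f x < c) ∧ ∀ x ∈ S, f x = c := by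
  obtain ⟨g, hg, h⟩ := relint_pt hS
  obtain ⟨f, hf1, hf2⟩ := supp_pt hK hi (y := g) (fun hgi => hne (ext_interior hE hg hgi))
  refine ⟨f, f g, hf1, hf2, fun s hs => le_antisymm (hf1 s (hE.subset (subset_convexHull ℝ _ hs))) ?_⟩
  obtain ⟨e, he, h2⟩ := h s (subset_affineSpan ℝ _ hs)
  have h3 := hf1 _ (hE.subset h2)
  have : g + e • (g - s) = (1 + e) • g + (-e) • s := by module
  rw [this, aff_comb f (by ring)] at h3
  nlinarith

theorem generic_pt {ι : Type*} {O : Set Pt3} (hO : IsOpen O) (hn : O.Nonempty) {s : Set ι}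
    (hs : s.Finite) (L : ι → AffineSubspace ℝ Pt3) (hL : ∀ i ∈ s, L i ≠ ⊤) :
    ∃ x ∈ O, ∀ i ∈ s, x ∉ L i := by
  by_contra hcon
  push Not at hcon
  have h1 : O ⊆ ⋃ i ∈ s, (L i : Set Pt3) := by
    intro x hx
    obtain ⟨i, hi, h⟩ := hcon x hx
    exact mem_biUnion hi h
  have h2 : volume (⋃ i ∈ s, (L i : Set Pt3)) = 0 := by
    rw [measure_biUnion_null_iff hs.countable]
    intro i hi
    exact Measure.addHaar_affineSubspace _ _ (hL i hi)
  exact (hO.measure_pos volume hn).ne' (measure_mono_null h1 h2)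

theorem span_ne_top {F : Finset Pt3} (h : F.card ≤ 3) : affineSpan ℝ (F : Set Pt3) ≠ ⊤ := by
  intro htop
  rcases F.eq_empty_or_nonempty with rfl | hne
  · simp at htop
  have h1 := finrank_vectorSpan_image_finset_le ℝ (id : Pt3 → Pt3) F (n := F.card - 1)
    (by have := hne.card_pos; omega)
  rw [Finset.image_id] at h1
  rw [← direction_affineSpan, htop, AffineSubspace.direction_top, finrank_top] at h1
  simp at h1
  omega

theorem interior_small {F : Finset Pt3} (h : F.card ≤ 3) : interior (cv (F : Set Pt3)) = ∅ := by
  by_contra hne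
  rw [← Ne, ← nonempty_iff_ne_empty, interior_convexHull_nonempty_iff_affineSpan_eq_top] at hne
  exact span_ne_top h hne

theorem tet_interior {σ : Finset Pt3} (h : IsTet σ) : (interior (cv (σ : Set Pt3))).Nonempty := by
  rw [interior_convexHull_nonempty_iff_affineSpan_eq_top]
  have := (h.2.affineSpan_eq_top_iff_card_eq_finrank_add_one).2 (by simp [h.1])
  simpa using this

theorem closed_hull (F : Finset Pt3) : IsClosed (cv (F : Set Pt3)) :=
  (F.finite_toSet.isCompact_convexHull ℝ).isClosed

/-- Interiors of distinct tetrahedra meeting face to face are disjoint. -/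
theorem interior_disj {σ τ : Finset Pt3} (hσ : IsTet σ) (hτ : IsTet τ) (hne : σ ≠ τ)
    (h : cv (σ : Set Pt3) ∩ cv (τ : Set Pt3) = cv ((σ ∩ τ : Finset Pt3) : Set Pt3)) :
    interior (cv (σ : Set Pt3)) ∩ interior (cv (τ : Set Pt3)) = ∅ := by
  rw [← interior_inter, h]
  apply interior_small
  by_contra hcard
  push Not at hcard
  have h1 : σ ∩ τ = σ := Finset.eq_of_subset_of_card_le Finset.inter_subset_left (by rw [hσ.1]; omega)
  have h2 : σ ∩ τ = τ := Finset.eq_of_subset_of_card_le Finset.inter_subset_right (by rw [hτ.1]; omega)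
  exact hne (h1.symm.trans h2)

/-- Purely combinatorial growth estimate for a connected family of tetrahedra. -/
theorem growth {α : Type*} [DecidableEq α] (H : Finset (Finset α)) (B : Finset α) (hne : H.Nonempty)
    (hH : ∀ σ ∈ H, σ.card = 4 ∧ ((σ ∩ B).card = 2 ∨ (σ ∩ B).card = 3))
    (conn : ∀ H1 ⊆ H, H1.Nonempty → H1 ≠ H →
      ∃ σ ∈ H1, ∃ τ ∈ H \ H1, (σ ∩ τ).card = 3 ∧ ((σ ∩ τ) ∩ B).card = 2) :
    ((H.biUnion id) ∩ B).card ≤ 2 + (H.filter (fun σ => (σ ∩ B).card = 3)).card ∧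
    ((H.biUnion id) \ B).card ≤ 1 + (H.filter (fun σ => (σ ∩ B).card = 2)).card := by
  have key : ∀ n : ℕ, n + 1 ≤ H.card → ∃ H1 ⊆ H, H1.card = n + 1 ∧
      ((H1.biUnion id) ∩ B).card ≤ 2 + (H1.filter (fun σ => (σ ∩ B).card = 3)).card ∧
      ((H1.biUnion id) \ B).card ≤ 1 + (H1.filter (fun σ => (σ ∩ B).card = 2)).card := by
    intro n
    induction n with
    | zero =>
      intro _
      obtain ⟨σ, hσ⟩ := hne
      refine ⟨{σ}, by simpa using hσ, by simp, ?_⟩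
      obtain ⟨h4, h⟩ := hH σ hσ
      have hs := Finset.card_sdiff_add_card_inter σ B
      simp only [Finset.singleton_biUnion, id, Finset.filter_singleton]
      rcases h with h | h <;> simp [h] <;> omega
    | succ n ih =>
      intro hn
      obtain ⟨H1, hsub, hcard, h1, h2⟩ := ih (by omega)
      have hne1 : H1 ≠ H := by rintro rfl; omega
      obtain ⟨σ, hσ, τ, hτ, h3, hb⟩ := conn H1 hsub (Finset.card_pos.1 (by omega)) hne1
      rw [Finset.mem_sdiff] at hτ
      refine ⟨insert τ H1, Finset.insert_subset hτ.1 hsub, by rw [Finset.card_insert_of_notMem hτ.2, hcard], ?_⟩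
      obtain ⟨h4, h⟩ := hH τ hτ.1
      have e1 : ((insert τ H1).biUnion id) ∩ B ⊆ ((H1.biUnion id) ∩ B) ∪ ((τ ∩ B) \ ((σ ∩ τ) ∩ B)) := by
        intro x hx
        simp only [Finset.biUnion_insert, id, Finset.mem_inter, Finset.mem_union, Finset.mem_biUnion, Finset.mem_sdiff] at hx ⊢
        by_cases hxs : x ∈ σ
        · exact Or.inl ⟨⟨σ, hσ, hxs⟩, hx.2⟩
        · rcases hx with ⟨h | h, hxB⟩
          · exact Or.inr ⟨⟨h, hxB⟩, fun h' => hxs h'.1.1⟩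
          · exact Or.inl ⟨h, hxB⟩
      have e2 : ((insert τ H1).biUnion id) \ B ⊆ ((H1.biUnion id) \ B) ∪ ((τ \ B) \ ((σ ∩ τ) \ B)) := by
        intro x hx
        simp only [Finset.biUnion_insert, id, Finset.mem_inter, Finset.mem_union, Finset.mem_biUnion, Finset.mem_sdiff] at hx ⊢
        by_cases hxs : x ∈ σ
        · exact Or.inl ⟨⟨σ, hσ, hxs⟩, hx.2⟩
        · rcases hx with ⟨h | h, hxB⟩
          · exact Or.inr ⟨⟨h, hxB⟩, fun h' => hxs h'.1.1⟩
          · exact Or.inl ⟨h, hxB⟩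
      have c1 := (Finset.card_le_card e1).trans (Finset.card_union_le _ _)
      have c2 := (Finset.card_le_card e2).trans (Finset.card_union_le _ _)
      rw [Finset.card_sdiff_of_subset (Finset.inter_subset_inter Finset.inter_subset_right (Finset.Subset.refl B))] at c1
      rw [Finset.card_sdiff_of_subset (Finset.sdiff_subset_sdiff Finset.inter_subset_right (Finset.Subset.refl B))] at c2
      have hs := Finset.card_sdiff_add_card_inter τ B
      have hs2 := Finset.card_sdiff_add_card_inter (σ ∩ τ) B
      rw [Finset.filter_insert, Finset.filter_insert]
      have n3 : τ ∉ H1.filter (fun σ => (σ ∩ B).card = 3) := fun h => hτ.2 (Finset.mem_filter.1 h).1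
      have n2 : τ ∉ H1.filter (fun σ => (σ ∩ B).card = 2) := fun h => hτ.2 (Finset.mem_filter.1 h).1
      rcases h with h | h
      · rw [if_neg (by omega), if_pos h, Finset.card_insert_of_notMem n2]
        constructor <;> omega
      · rw [if_pos h, if_neg (by omega), Finset.card_insert_of_notMem n3]
        constructor <;> omega
  have hp := hne.card_pos
  obtain ⟨H1, hsub, hcard, h⟩ := key (H.card - 1) (by omega)
  have : H1 = H := Finset.eq_of_subset_of_card_le hsub (by omega)
  rwa [this] at h

def Pts (V : Set Pt3) : Prop := ∀ x ∈ V, IsExtreme ℝ (cv V) {x}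

theorem Pts.mem {V G : Set Pt3} (h : Pts V) (hG : G ⊆ V) {x : Pt3} (hx : x ∈ V) (hxG : x ∈ cv G) :
    x ∈ G := by
  have := ext_inter (h x hx) (convex_convexHull ℝ _) (hG.trans (subset_convexHull ℝ _)) hxG rfl
  have h2 := (convexHull_nonempty_iff (𝕜 := ℝ)).1 ⟨x, this⟩
  obtain ⟨y, hy, rfl⟩ := h2
  exact hy

theorem Pts.mono {V W : Set Pt3} (h : Pts V) (hW : W ⊆ V) : Pts W := by
  intro x hx
  refine (h x (hW hx)).mono (convexHull_mono hW) ?_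
  rintro y rfl
  exact subset_convexHull ℝ _ hx

theorem Pts.face {V G F : Set Pt3} (h : Pts V) (hG : G ⊆ V) (hE : IsExtreme ℝ (cv V) (cv G))
    (hF : F ⊆ V) {z : Pt3} (hz : z ∈ cv F) (hzG : z ∈ cv G) : z ∈ cv (F ∩ G) := by
  have := ext_inter hE (convex_convexHull ℝ _) (hF.trans (subset_convexHull ℝ _)) hz hzG
  refine convexHull_mono ?_ this
  rintro x ⟨hx, hx2⟩
  exact ⟨hx, h.mem hG (hF hx) hx2⟩

/-- Points of `V` hit no segment of `cv V` except at its ends. -/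
theorem Pts.seg {V : Set Pt3} (h : Pts V) {v x y : Pt3} (hv : v ∈ V) (hx : x ∈ cv V) (hy : y ∈ cv V)
    (hs : v ∈ segment ℝ x y) : v = x ∨ v = y := by
  by_cases h1 : x = v
  · exact Or.inl h1.symm
  by_cases h2 : y = v
  · exact Or.inr h2.symm
  have := mem_openSegment_of_ne_left_right h1 h2 hs
  exact absurd ((h v hv).left_mem_of_mem_openSegment hx hy rfl this) h1

theorem Pts.mid {V : Set Pt3} (h : Pts V) {a b : Pt3} (ha : a ∈ V) (hb : b ∈ V) (hab : a ≠ b) :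
    midpoint ℝ a b ∉ V := by
  intro hm
  rcases h.seg hm (subset_convexHull ℝ _ ha) (subset_convexHull ℝ _ hb) (midpoint_mem_segment a b) with h | h
  · exact hab (by simpa using h)
  · exact hab (by simpa using h)

/-- The union of hulls of vertex sets with at most one vertex in `B`. -/
def lowSet (V B : Finset Pt3) : Set Pt3 :=
  ⋃ F ∈ V.powerset.filter (fun F => (F ∩ B).card ≤ 1), cv (F : Set Pt3)

theorem lowSet_closed (V B : Finset Pt3) : IsClosed (lowSet V B) := by
  apply isClosed_biUnion_finset
  intro F _
  exact closed_hull F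

theorem lowSet_face {V B : Finset Pt3} (hP : Pts (V : Set Pt3)) (hB : B ⊆ V)
    (hE : IsExtreme ℝ (cv V) (cv B)) {z : Pt3} (hz : z ∈ lowSet V B) (hzB : z ∈ cv (B : Set Pt3)) :
    z ∈ V := by
  simp only [lowSet, mem_iUnion] at hz
  obtain ⟨F, hF, hz⟩ := hz
  simp only [Finset.mem_filter, Finset.mem_powerset] at hF
  have h1 := hP.face (by exact_mod_cast hB) hE (by exact_mod_cast hF.1) hz hzB
  rw [← Finset.coe_inter] at h1
  rcases Nat.le_one_iff_eq_zero_or_eq_one.1 hF.2 with h | h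
  · rw [Finset.card_eq_zero] at h
    rw [h] at h1
    simp at h1
  · obtain ⟨x, hx⟩ := Finset.card_eq_one.1 h
    rw [hx] at h1
    simp at h1
    subst h1
    have : z ∈ F ∩ B := by rw [hx]; simp
    exact hF.1 (Finset.mem_inter.1 this).1

theorem notLow {V B F : Finset Pt3} (hF : F ⊆ V) {z : Pt3} (hz : z ∈ cv (F : Set Pt3))
    (hn : z ∉ lowSet V B) : 2 ≤ (F ∩ B).card := by
  by_contra hcon
  apply hn
  simp only [lowSet, mem_iUnion]
  exact ⟨F, by simp only [Finset.mem_filter, Finset.mem_powerset]; exact ⟨hF, by omega⟩, hz⟩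

theorem conn_lemma {V B : Finset Pt3} (hP : Pts (V : Set Pt3)) (hB : B ⊆ V)
    (hE : IsExtreme ℝ (cv V) (cv B)) (hne : ¬ cv (V : Set Pt3) ⊆ cv B)
    {T : Finset (Finset Pt3)} (hT : IsTriangulation V T) {H1 H2 : Finset (Finset Pt3)}
    (h1 : H1.Nonempty) (h2 : H2.Nonempty) (hd : ∀ σ ∈ H1, σ ∉ H2)
    (hH : ∀ σ, (σ ∈ H1 ∨ σ ∈ H2) ↔ σ ∈ T ∧ 2 ≤ (σ ∩ B).card) :
    ∃ σ ∈ H1, ∃ τ ∈ H2, (σ ∩ τ).card = 3 ∧ ((σ ∩ τ) ∩ B).card = 2 := by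
  obtain ⟨⟨hT1, hT2, hT3⟩, hT4⟩ := hT
  have pick : ∀ σ, σ ∈ T ∧ 2 ≤ (σ ∩ B).card → ∃ x0 ∈ cv (B : Set Pt3), x0 ∉ V ∧ x0 ∈ cv (σ : Set Pt3) := by
    rintro σ ⟨hσ, hc⟩
    obtain ⟨a, ha, b, hb, hab⟩ := Finset.one_lt_card.1 (show 1 < (σ ∩ B).card by omega)
    rw [Finset.mem_inter] at ha hb
    refine ⟨midpoint ℝ a b, ?_, ?_, ?_⟩
    · exact (convex_convexHull ℝ _).midpoint_mem (subset_convexHull ℝ _ ha.2) (subset_convexHull ℝ _ hb.2)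
    · exact hP.mid (hB ha.2) (hB hb.2) hab
    · exact (convex_convexHull ℝ _).midpoint_mem (subset_convexHull ℝ _ ha.1) (subset_convexHull ℝ _ hb.1)
  obtain ⟨σ, hσ⟩ := h1
  obtain ⟨τ, hτ⟩ := h2
  have hσT := (hH σ).1 (Or.inl hσ)
  have hτT := (hH τ).1 (Or.inr hτ)
  obtain ⟨x0, hx0B, hx0V, hx0σ⟩ := pick σ hσT
  obtain ⟨y0, hy0B, hy0V, hy0τ⟩ := pick τ hτT
  have hBV : cv (B : Set Pt3) ⊆ cv V := hE.subset
  have hdisj : Disjoint (segment ℝ x0 y0) (lowSet V B) := by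
    rw [Set.disjoint_left]
    intro z hz hzl
    have hzB : z ∈ cv (B : Set Pt3) := (convex_convexHull ℝ _).segment_subset hx0B hy0B hz
    have hzV := lowSet_face hP hB hE hzl hzB
    rcases hP.seg hzV (hBV hx0B) (hBV hy0B) hz with h | h
    · exact hx0V (h ▸ hzV)
    · exact hy0V (h ▸ hzV)
  have hcompact : IsCompact (segment ℝ x0 y0) := by
    rw [← convexHull_pair]
    exact (Set.toFinite _).isCompact_convexHull ℝ
  obtain ⟨δ, hδ, hth⟩ := hdisj.exists_thickenings hcompact (lowSet_closed V B)
  set U := Metric.thickening δ (segment ℝ x0 y0) with hU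
  have hUo : IsOpen U := Metric.isOpen_thickening
  have hUc : Convex ℝ U := (convex_segment x0 y0).thickening δ
  have hUl : ∀ z ∈ U, z ∉ lowSet V B := fun z hz hzl =>
    Set.disjoint_left.1 hth hz (Metric.self_subset_thickening hδ _ hzl)
  have near : ∀ ρ ∈ T, ∀ x ∈ cv (ρ : Set Pt3), x ∈ U → (U ∩ interior (cv (ρ : Set Pt3))).Nonempty := by
    intro ρ hρ x hx hxU
    have h1 : x ∈ closure (interior (cv (ρ : Set Pt3))) := by
      rw [(convex_convexHull ℝ _).closure_interior_eq_closure_of_nonempty_interior (tet_interior (hT1 ρ hρ).1)]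
      exact subset_closure hx
    exact mem_closure_iff.1 h1 U hUo hxU
  have hx0U : x0 ∈ U := Metric.self_subset_thickening hδ _ (left_mem_segment ℝ _ _)
  have hy0U : y0 ∈ U := Metric.self_subset_thickening hδ _ (right_mem_segment ℝ _ _)
  let 𝓕 : Set (Finset Pt3) := {F | F ⊆ V ∧ F.card ≤ 2}
  have h𝓕 : 𝓕.Finite := (V.powerset.finite_toSet).subset (fun F hF => by simpa using hF.1)
  obtain ⟨x, ⟨hxU, hxi⟩, hxg⟩ := generic_pt (hUo.inter isOpen_interior) (near σ hσT.1 x0 hx0σ hx0U) h𝓕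
    (fun F => affineSpan ℝ (F : Set Pt3)) (fun F hF => span_ne_top (by have := hF.2; omega))
  obtain ⟨y, ⟨hyU, hyi⟩, hyg⟩ := generic_pt (hUo.inter isOpen_interior) (near τ hτT.1 y0 hy0τ hy0U) h𝓕
    (fun F => affineSpan ℝ ((insert x F : Finset Pt3) : Set Pt3)) (fun F hF => span_ne_top (by
      have := hF.2
      have := Finset.card_insert_le x F; omega))
  have hTV : ∀ ρ ∈ T, cv (ρ : Set Pt3) ⊆ cv V := fun ρ hρ => convexHull_mono (hT1 ρ hρ).2
  have hsegi : segment ℝ x y ⊆ interior (cv (V : Set Pt3)) :=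
    ((convex_convexHull ℝ _).interior).segment_subset (interior_mono (hTV σ hσT.1) hxi)
      (interior_mono (hTV τ hτT.1) hyi)
  have hsegU : segment ℝ x y ⊆ U := hUc.segment_subset hxU hyU
  have hpre : IsPreconnected (segment ℝ x y) := (convex_segment x y).isPreconnected
  rw [isPreconnected_closed_iff] at hpre
  obtain ⟨z, hz, hz1, hz2⟩ := hpre (⋃ ρ ∈ H1, cv (ρ : Set Pt3)) (⋃ ρ ∈ H2, cv (ρ : Set Pt3))
    (isClosed_biUnion_finset fun F _ => closed_hull F) (isClosed_biUnion_finset fun F _ => closed_hull F)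
    (by
      intro z hz
      have hzV : z ∈ cv (V : Set Pt3) := interior_subset (hsegi hz)
      change z ∈ convexHull ℝ (V : Set Pt3) at hzV
      rw [← hT3] at hzV
      simp only [mem_iUnion] at hzV
      obtain ⟨ρ, hρ, hzρ⟩ := hzV
      have hc := notLow (by exact_mod_cast (hT1 ρ hρ).2) hzρ (hUl z (hsegU hz))
      rcases (hH ρ).2 ⟨hρ, hc⟩ with h | h
      · exact Or.inl (mem_biUnion h hzρ)
      · exact Or.inr (mem_biUnion h hzρ))
    ⟨x, left_mem_segment ℝ _ _, mem_biUnion (show σ ∈ (H1 : Set _) from hσ) (interior_subset hxi)⟩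
    ⟨y, right_mem_segment ℝ _ _, mem_biUnion (show τ ∈ (H2 : Set _) from hτ) (interior_subset hyi)⟩
  simp only [mem_iUnion] at hz1 hz2
  obtain ⟨σ1, hσ1, hz1⟩ := hz1
  obtain ⟨σ2, hσ2, hz2⟩ := hz2
  have hσ1T := (hH σ1).1 (Or.inl hσ1)
  have hσ2T := (hH σ2).1 (Or.inr hσ2)
  have hzF : z ∈ convexHull ℝ ((σ1 ∩ σ2 : Finset Pt3) : Set Pt3) := by
    rw [← hT4 σ1 hσ1T.1 σ2 hσ2T.1]; exact ⟨hz1, hz2⟩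
  have hFV : σ1 ∩ σ2 ⊆ V := fun a ha => by
    exact_mod_cast (hT1 σ1 hσ1T.1).2 (Finset.mem_coe.2 (Finset.mem_inter.1 ha).1)
  have hlow := notLow hFV hzF (hUl z (hsegU hz))
  have hc4 : (σ1 ∩ σ2).card ≤ 3 := by
    by_contra hcon
    push Not at hcon
    have e1 : σ1 ∩ σ2 = σ1 := Finset.eq_of_subset_of_card_le Finset.inter_subset_left
      (by rw [(hT1 σ1 hσ1T.1).1.1]; omega)
    have e2 : σ1 ∩ σ2 = σ2 := Finset.eq_of_subset_of_card_le Finset.inter_subset_right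
      (by rw [(hT1 σ2 hσ2T.1).1.1]; omega)
    have e3 : σ1 = σ2 := e1.symm.trans e2
    exact hd σ1 hσ1 (e3 ▸ hσ2)
  have hc2 : ¬ (σ1 ∩ σ2).card ≤ 2 := by
    intro hc
    have hmem : σ1 ∩ σ2 ∈ 𝓕 := ⟨hFV, hc⟩
    have hzs : z ∈ affineSpan ℝ ((σ1 ∩ σ2 : Finset Pt3) : Set Pt3) := convexHull_subset_affineSpan _ hzF
    have hzx : z ≠ x := fun h => hxg _ hmem (h ▸ hzs)
    apply hyg _ hmem
    have hzs2 : z ∈ affineSpan ℝ ((insert x (σ1 ∩ σ2) : Finset Pt3) : Set Pt3) :=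
      affineSpan_mono ℝ (by simp) hzs
    have hxs2 : x ∈ affineSpan ℝ ((insert x (σ1 ∩ σ2) : Finset Pt3) : Set Pt3) :=
      subset_affineSpan ℝ _ (by simp)
    obtain ⟨a, b, ha, hb, hab, hzab⟩ := hz
    have hb0 : b ≠ 0 := by
      rintro rfl
      apply hzx
      rw [← hzab, show a = 1 by linarith]; simp
    have := AffineMap.lineMap_mem (1 / b) hxs2 hzs2
    convert this using 1
    rw [AffineMap.lineMap_apply, ← hzab, show a = 1 - b by linarith]
    ext i
    simp
    field_simp
    ring
  have hc3 : (σ1 ∩ σ2).card = 3 := by omega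
  refine ⟨σ1, hσ1, σ2, hσ2, hc3, ?_⟩
  by_contra hcon
  have h3 : ((σ1 ∩ σ2) ∩ B).card ≤ 3 := (Finset.card_le_card Finset.inter_subset_left).trans hc4
  have e : (σ1 ∩ σ2) ∩ B = σ1 ∩ σ2 := Finset.eq_of_subset_of_card_le Finset.inter_subset_left (by omega)
  have hzB : z ∈ cv (B : Set Pt3) := by
    refine convexHull_mono ?_ hzF
    rw [← e]
    exact Finset.coe_subset.2 Finset.inter_subset_right
  exact hne (ext_interior hE hzB (hsegi hz))

def nx (m i : ℕ) : ℕ := if i + 1 = m then 0 else i + 1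

def capF (p : Bool → ℕ → Pt3) (m : ℕ) (b : Bool) : Finset Pt3 := (Finset.range m).image (p b)

def sideF (p : Bool → ℕ → Pt3) (m i : ℕ) : Finset Pt3 :=
  {p false i, p true i, p false (nx m i), p true (nx m i)}

structure Prism (m : ℕ) (V : Finset Pt3) (p : Bool → ℕ → Pt3) : Prop where
  hm : 3 ≤ m
  inj : ∀ b b' i j, i < m → j < m → p b i = p b' j → b = b' ∧ i = j
  V_eq : V = capF p m false ∪ capF p m true
  pts : Pts (V : Set Pt3)
  cap : ∀ b, IsExtreme ℝ (cv (V : Set Pt3)) (cv (capF p m b : Set Pt3))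
  side : ∀ i < m, IsExtreme ℝ (cv (V : Set Pt3)) (cv (sideF p m i : Set Pt3))
  complete : ∀ S ⊆ V, S ≠ V → IsExtreme ℝ (cv (V : Set Pt3)) (cv (S : Set Pt3)) →
    (∃ b, S ⊆ capF p m b) ∨ ∃ i < m, S ⊆ sideF p m i

namespace Prism

variable {m : ℕ} {V : Finset Pt3} {p : Bool → ℕ → Pt3}

theorem mem_V (P : Prism m V p) {x : Pt3} : x ∈ V ↔ ∃ b, ∃ i < m, p b i = x := by
  rw [P.V_eq]
  simp [capF]

theorem mem_cap {x : Pt3} {b : Bool} : x ∈ capF p m b ↔ ∃ i < m, p b i = x := by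
  simp [capF]

theorem p_mem (P : Prism m V p) (b : Bool) {i : ℕ} (hi : i < m) : p b i ∈ V := P.mem_V.2 ⟨b, i, hi, rfl⟩

theorem p_mem_cap (P : Prism m V p) (b b' : Bool) {i : ℕ} (hi : i < m) :
    p b i ∈ capF p m b' ↔ b = b' := by
  rw [mem_cap]
  constructor
  · rintro ⟨j, hj, h⟩
    exact (P.inj _ _ _ _ hj hi h).1.symm
  · rintro rfl
    exact ⟨i, hi, rfl⟩

theorem cap_sub (P : Prism m V p) (b : Bool) : capF p m b ⊆ V := by
  intro x hx
  obtain ⟨i, hi, rfl⟩ := mem_cap.1 hx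
  exact P.p_mem b hi

theorem nx_lt (P : Prism m V p) {i : ℕ} (hi : i < m) : nx m i < m := by
  have := P.hm
  unfold nx; split_ifs <;> omega

theorem nx_ne (P : Prism m V p) {i : ℕ} : nx m i ≠ i := by
  have := P.hm
  unfold nx; split_ifs <;> omega

theorem side_sub (P : Prism m V p) {i : ℕ} (hi : i < m) : sideF p m i ⊆ V := by
  intro x hx
  simp only [sideF, Finset.mem_insert, Finset.mem_singleton] at hx
  rcases hx with rfl | rfl | rfl | rfl
  · exact P.p_mem _ hi
  · exact P.p_mem _ hi
  · exact P.p_mem _ (P.nx_lt hi)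
  · exact P.p_mem _ (P.nx_lt hi)

theorem sdiff_cap (P : Prism m V p) (b : Bool) : V \ capF p m b = capF p m (!b) := by
  ext x
  rw [Finset.mem_sdiff, P.mem_V]
  constructor
  · rintro ⟨⟨b', i, hi, rfl⟩, h⟩
    rw [P.p_mem_cap _ _ hi] at h
    rw [P.p_mem_cap _ _ hi]
    cases b <;> cases b' <;> simp_all
  · intro h
    obtain ⟨i, hi, rfl⟩ := mem_cap.1 h
    refine ⟨⟨_, i, hi, rfl⟩, ?_⟩
    rw [P.p_mem_cap _ _ hi]
    simp

theorem cap_card (P : Prism m V p) (b : Bool) : (capF p m b).card = m := by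
  unfold capF
  rw [Finset.card_image_of_injOn]
  · simp
  · intro i hi j hj h
    simp at hi hj
    exact (P.inj _ _ _ _ hi hj h).2

theorem cap_proper (P : Prism m V p) (b : Bool) : ¬ cv (V : Set Pt3) ⊆ cv (capF p m b : Set Pt3) := by
  intro h
  have h0 : 0 < m := by have := P.hm; omega
  have h1 : p (!b) 0 ∈ cv (capF p m b : Set Pt3) := h (subset_convexHull ℝ _ (P.p_mem _ h0))
  have h2 := P.pts.mem (by exact_mod_cast P.cap_sub b) (P.p_mem (!b) h0) h1
  have h3 := (P.p_mem_cap _ _ h0).1 (Finset.mem_coe.1 h2)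
  simp at h3

/-- Every side face contributes a tetrahedron with a bottom edge. -/
theorem side_tet (P : Prism m V p) (b : Bool) {T : Finset (Finset Pt3)} (hT : IsTriangulation V T)
    {i : ℕ} (hi : i < m) : ∃ σ ∈ T, p b i ∈ σ ∧ p b (nx m i) ∈ σ ∧
      ∃ j, (j = i ∨ j = nx m i) ∧ p (!b) j ∈ σ := by
  obtain ⟨⟨hT1, hT2, hT3⟩, hT4⟩ := hT
  have hni := P.nx_lt hi
  set B := capF p m b with hB
  set x0 := midpoint ℝ (p b i) (p b (nx m i)) with hx0
  set q := p (!b) i with hq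
  have hx0V : x0 ∉ V := P.pts.mid (P.p_mem b hi) (P.p_mem b hni) (by
    intro h
    exact P.nx_ne (P.inj _ _ _ _ hi hni h).2.symm)
  have hx0B : x0 ∈ cv (B : Set Pt3) := (convex_convexHull ℝ _).midpoint_mem
    (subset_convexHull ℝ _ (Finset.mem_coe.2 ((P.p_mem_cap b b hi).2 rfl)))
    (subset_convexHull ℝ _ (Finset.mem_coe.2 ((P.p_mem_cap b b hni).2 rfl)))
  have hs : ∀ b', p b' i ∈ sideF p m i ∧ p b' (nx m i) ∈ sideF p m i := by
    intro b'; cases b' <;> simp [sideF]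
  have hx0Q : x0 ∈ cv (sideF p m i : Set Pt3) := (convex_convexHull ℝ _).midpoint_mem
    (subset_convexHull ℝ _ (hs b).1) (subset_convexHull ℝ _ (hs b).2)
  have hqQ : q ∈ cv (sideF p m i : Set Pt3) := subset_convexHull ℝ _ (hs (!b)).1
  have hx0l : x0 ∉ lowSet V B := fun h => hx0V (lowSet_face P.pts (P.cap_sub b) (P.cap b) h hx0B)
  have hc : Continuous (fun t : ℝ => AffineMap.lineMap x0 q t) := AffineMap.lineMap_continuous
  have hn : (fun t : ℝ => AffineMap.lineMap x0 q t) ⁻¹' (lowSet V B)ᶜ ∈ nhds (0 : ℝ) := by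
    apply hc.continuousAt.preimage_mem_nhds
    simp only [AffineMap.lineMap_apply_zero]
    exact (lowSet_closed V B).isOpen_compl.mem_nhds hx0l
  obtain ⟨e, he, hball⟩ := Metric.mem_nhds_iff.1 hn
  set t := min (e / 2) (1 / 2) with ht
  have ht0 : 0 < t := by positivity
  have ht1 : t < 1 := by
    have := min_le_right (e/2) (1/2 : ℝ); linarith
  have hte : t < e := by
    have := min_le_left (e/2) (1/2 : ℝ); linarith
  set z := AffineMap.lineMap x0 q t with hz
  have hzl : z ∉ lowSet V B := hball (by simp [abs_of_pos ht0, hte])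
  have hzo : z ∈ openSegment ℝ x0 q := by
    rw [openSegment_eq_image_lineMap]
    exact ⟨t, ⟨ht0, ht1⟩, rfl⟩
  have hzQ : z ∈ cv (sideF p m i : Set Pt3) := (convex_convexHull ℝ _).openSegment_subset hx0Q hqQ hzo
  have hzB : z ∉ cv (B : Set Pt3) := by
    intro h
    have h2 := (P.cap b).right_mem_of_mem_openSegment ((P.cap b).subset hx0B)
      ((P.side i hi).subset hqQ) h hzo
    have h3 := P.pts.mem (by exact_mod_cast P.cap_sub b) (P.p_mem (!b) hi) h2
    have h4 := (P.p_mem_cap _ _ hi).1 (Finset.mem_coe.1 h3)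
    simp at h4
  have hzV : z ∈ convexHull ℝ (V : Set Pt3) := (P.side i hi).subset hzQ
  rw [← hT3] at hzV
  simp only [mem_iUnion] at hzV
  obtain ⟨σ, hσ, hzσ⟩ := hzV
  have hσV : σ ⊆ V := by exact_mod_cast (hT1 σ hσ).2
  have hzF := P.pts.face (by exact_mod_cast P.side_sub hi) (P.side i hi) (hT1 σ hσ).2 hzσ hzQ
  rw [← Finset.coe_inter] at hzF
  have hcard := notLow (Finset.inter_subset_left.trans hσV) hzF hzl
  have hsub : (σ ∩ sideF p m i) ∩ B ⊆ {p b i, p b (nx m i)} := by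
    intro x hx
    simp only [Finset.mem_inter, sideF, Finset.mem_insert, Finset.mem_singleton] at hx ⊢
    obtain ⟨⟨_, hx⟩, hxB⟩ := hx
    rcases hx with rfl | rfl | rfl | rfl
    all_goals
      first
      | rw [P.p_mem_cap _ _ hi] at hxB
      | rw [P.p_mem_cap _ _ hni] at hxB
      subst hxB
      simp
  have heq : (σ ∩ sideF p m i) ∩ B = {p b i, p b (nx m i)} :=
    Finset.eq_of_subset_of_card_le hsub (Finset.card_le_two.trans hcard)
  refine ⟨σ, hσ, ?_, ?_, ?_⟩
  · have : p b i ∈ (σ ∩ sideF p m i) ∩ B := by rw [heq]; simp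
    exact (Finset.mem_inter.1 (Finset.mem_inter.1 this).1).1
  · have : p b (nx m i) ∈ (σ ∩ sideF p m i) ∩ B := by rw [heq]; simp
    exact (Finset.mem_inter.1 (Finset.mem_inter.1 this).1).1
  · by_contra hcon
    push Not at hcon
    apply hzB
    refine convexHull_mono ?_ hzF
    intro x hx
    rw [Finset.mem_coe, Finset.mem_inter] at hx
    obtain ⟨hxσ, hx⟩ := hx
    have h1 := hcon i (Or.inl rfl)
    have h2 := hcon _ (Or.inr rfl)
    rw [Finset.mem_coe]
    simp only [sideF, Finset.mem_insert, Finset.mem_singleton] at hx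
    rcases hx with rfl | rfl | rfl | rfl
    all_goals
      first
      | rw [P.p_mem_cap _ _ hi]
      | rw [P.p_mem_cap _ _ hni]
      cases b <;> simp_all

theorem lower_aux (P : Prism m V p) (b : Bool) {T : Finset (Finset Pt3)} (hT : IsTriangulation V T) :
    m ≤ 2 + (T.filter (fun σ => (σ ∩ capF p m b).card = 3)).card ∧
    (m + 1) / 2 ≤ 1 + (T.filter (fun σ => (σ ∩ capF p m b).card = 2)).card ∧
    ∀ σ ∈ T, (σ ∩ capF p m b).card + (σ ∩ capF p m (!b)).card = 4 ∧ (σ ∩ capF p m b).card ≤ 3 := by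
  have hm := P.hm
  have hT1 := hT.1.1
  set B := capF p m b with hB
  have htype : ∀ σ ∈ T, (σ ∩ B).card + (σ ∩ capF p m (!b)).card = 4 ∧ (σ ∩ B).card ≤ 3 := by
    intro σ hσ
    have hσV : σ ⊆ V := by exact_mod_cast (hT1 σ hσ).2
    have h1 := Finset.card_sdiff_add_card_inter σ B
    have h2 : σ \ B = σ ∩ capF p m (!b) := by
      rw [← P.sdiff_cap b]
      ext x
      simp only [Finset.mem_sdiff, Finset.mem_inter]
      exact ⟨fun h => ⟨h.1, hσV h.1, h.2⟩, fun h => ⟨h.1, h.2.2⟩⟩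
    rw [h2, (hT1 σ hσ).1.1] at h1
    refine ⟨by omega, ?_⟩
    by_contra hcon
    have h3 : σ ∩ B = σ := Finset.eq_of_subset_of_card_le Finset.inter_subset_left
      (by rw [(hT1 σ hσ).1.1]; omega)
    obtain ⟨z, hz⟩ := tet_interior (hT1 σ hσ).1
    have hσB : cv (σ : Set Pt3) ⊆ cv (B : Set Pt3) := by
      apply convexHull_mono
      rw [← h3]
      exact Finset.coe_subset.2 Finset.inter_subset_right
    exact P.cap_proper b (ext_interior (P.cap b) (hσB (interior_subset hz))
      (interior_mono (convexHull_mono (hT1 σ hσ).2) hz))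
  set H := T.filter (fun σ => 2 ≤ (σ ∩ B).card) with hH
  have hside : ∀ i < m, ∃ σ ∈ H, p b i ∈ σ ∧ p b (nx m i) ∈ σ ∧
      ∃ j, (j = i ∨ j = nx m i) ∧ p (!b) j ∈ σ := by
    intro i hi
    obtain ⟨σ, hσ, h1, h2, h3⟩ := P.side_tet b hT hi
    refine ⟨σ, Finset.mem_filter.2 ⟨hσ, ?_⟩, h1, h2, h3⟩
    have : 1 < (σ ∩ B).card := Finset.one_lt_card.2 ⟨p b i,
      Finset.mem_inter.2 ⟨h1, (P.p_mem_cap b b hi).2 rfl⟩, p b (nx m i),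
      Finset.mem_inter.2 ⟨h2, (P.p_mem_cap b b (P.nx_lt hi)).2 rfl⟩,
      fun h => P.nx_ne (P.inj _ _ _ _ hi (P.nx_lt hi) h).2.symm⟩
    omega
  have hHne : H.Nonempty := by
    obtain ⟨σ, hσ, _⟩ := hside 0 (by omega)
    exact ⟨σ, hσ⟩
  obtain ⟨g1, g2⟩ := growth H B hHne (by
      intro σ hσ
      have h := Finset.mem_filter.1 hσ
      have := (htype σ h.1).2
      exact ⟨(hT1 σ h.1).1.1, by omega⟩) (by
      intro H1 hsub hne1 hne2
      apply conn_lemma P.pts (P.cap_sub b) (P.cap b) (P.cap_proper b) hT hne1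
      · rw [Finset.sdiff_nonempty]
        intro h
        exact hne2 (Finset.Subset.antisymm hsub h)
      · intro σ h1 h2
        exact (Finset.mem_sdiff.1 h2).2 h1
      · intro σ
        have e : σ ∈ T ∧ 2 ≤ (σ ∩ B).card ↔ σ ∈ H := by rw [hH, Finset.mem_filter]
        rw [e, Finset.mem_sdiff]
        constructor
        · rintro (h | h)
          · exact hsub h
          · exact h.1
        · intro h
          by_cases h' : σ ∈ H1
          · exact Or.inl h'
          · exact Or.inr ⟨h, h'⟩)
  have s3 : (H.filter (fun σ => (σ ∩ B).card = 3)).card ≤ (T.filter (fun σ => (σ ∩ B).card = 3)).card :=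
    Finset.card_le_card (Finset.filter_subset_filter _ (Finset.filter_subset _ _))
  have s2 : (H.filter (fun σ => (σ ∩ B).card = 2)).card ≤ (T.filter (fun σ => (σ ∩ B).card = 2)).card :=
    Finset.card_le_card (Finset.filter_subset_filter _ (Finset.filter_subset _ _))
  refine ⟨?_, ?_, htype⟩
  · have : B ⊆ (H.biUnion id) ∩ B := by
      intro x hx
      rw [Finset.mem_inter, Finset.mem_biUnion]
      obtain ⟨i, hi, rfl⟩ := mem_cap.1 hx
      obtain ⟨σ, hσ, h1, _⟩ := hside i hi
      exact ⟨⟨σ, hσ, h1⟩, hx⟩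
    have := Finset.card_le_card this
    rw [P.cap_card] at this
    omega
  · choose! s hs1 hs2 hs3 j hj1 hj2 using hside
    have hmap : ∀ i ∈ Finset.range m, p (!b) (j i) ∈ (H.biUnion id) \ B := by
      intro i hi
      rw [Finset.mem_range] at hi
      rw [Finset.mem_sdiff, Finset.mem_biUnion]
      refine ⟨⟨s i, hs1 i hi, hj2 i hi⟩, ?_⟩
      have hji : j i < m := by
        rcases hj1 i hi with h | h
        · omega
        · rw [h]; exact P.nx_lt hi
      rw [P.p_mem_cap _ _ hji]
      simp
    have hcount := Finset.card_le_mul_card_image_of_maps_to hmap 2 (by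
      intro x hx
      by_cases hex : ∃ i0 < m, p (!b) (j i0) = x
      · obtain ⟨i0, hi0, rfl⟩ := hex
        have hsub : (Finset.range m).filter (fun i => p (!b) (j i) = p (!b) (j i0)) ⊆
            {j i0, if j i0 = 0 then m - 1 else j i0 - 1} := by
          intro i hi
          rw [Finset.mem_filter, Finset.mem_range] at hi
          have l1 : ∀ i < m, j i < m := by
            intro i hi
            rcases hj1 i hi with h | h
            · omega
            · rw [h]; exact P.nx_lt hi
          have he := (P.inj _ _ _ _ (l1 i hi.1) (l1 i0 hi0) hi.2).2
          rw [← he, Finset.mem_insert, Finset.mem_singleton]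
          rcases hj1 i hi.1 with h | h
          · left; omega
          · right
            rw [h]
            have := hi.1
            by_cases h' : i + 1 = m
            · have e : nx m i = 0 := by simp [nx, h']
              rw [e, if_pos rfl]; omega
            · have e : nx m i = i + 1 := by simp [nx, h']
              rw [e, if_neg (by omega)]; omega
        exact (Finset.card_le_card hsub).trans Finset.card_le_two
      · rw [Finset.card_eq_zero.2]
        · omega
        · rw [Finset.filter_eq_empty_iff]
          intro i hi h
          exact hex ⟨i, Finset.mem_range.1 hi, h⟩)
    rw [Finset.card_range] at hcount
    omega

theorem lower (P : Prism m V p) {T : Finset (Finset Pt3)} (hT : IsTriangulation V T) :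
    2 * m - 5 + (m + 1) / 2 ≤ T.card := by
  obtain ⟨a1, a2, a3⟩ := P.lower_aux false hT
  obtain ⟨b1, _, _⟩ := P.lower_aux true hT
  have hm := P.hm
  have h1 : T.filter (fun σ => (σ ∩ capF p m true).card = 3) ⊆
      T.filter (fun σ => (σ ∩ capF p m false).card = 1) := by
    intro σ hσ
    rw [Finset.mem_filter] at hσ ⊢
    have := (a3 σ hσ.1).1
    simp only [Bool.not_false] at this
    exact ⟨hσ.1, by omega⟩
  have h1' := Finset.card_le_card h1
  have d1 : Disjoint (T.filter (fun σ => (σ ∩ capF p m false).card = 3))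
      (T.filter (fun σ => (σ ∩ capF p m false).card = 2)) := by
    rw [Finset.disjoint_filter]; intros; omega
  have d2 : Disjoint (T.filter (fun σ => (σ ∩ capF p m false).card = 3) ∪
      T.filter (fun σ => (σ ∩ capF p m false).card = 2))
      (T.filter (fun σ => (σ ∩ capF p m false).card = 1)) := by
    rw [← Finset.filter_or, Finset.disjoint_filter]; intros; omega
  have hc := Finset.card_le_card (Finset.union_subset (Finset.union_subset
    (Finset.filter_subset (fun σ => (σ ∩ capF p m false).card = 3) T)
    (Finset.filter_subset (fun σ => (σ ∩ capF p m false).card = 2) T))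
    (Finset.filter_subset (fun σ => (σ ∩ capF p m false).card = 1) T))
  rw [Finset.card_union_of_disjoint d2, Finset.card_union_of_disjoint d1] at hc
  omega

end Prism

/-- Degenerate pieces may be dropped from a finite cover. -/
theorem drop_deg {W V : Finset Pt3} (hi : (interior (cv (W : Set Pt3))).Nonempty)
    {R : Finset Pt3 → Prop}
    (h : ∀ x ∈ interior (cv (W : Set Pt3)), ∃ Q ⊆ V, R Q ∧ x ∈ cv (Q : Set Pt3)) :
    ∀ x ∈ cv (W : Set Pt3), ∃ Q ⊆ V, R Q ∧ (interior (cv (Q : Set Pt3))).Nonempty ∧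
      x ∈ cv (Q : Set Pt3) := by
  intro x hx
  by_contra hcon
  push Not at hcon
  set 𝓕 := V.powerset.filter (fun Q => R Q ∧ (interior (cv (Q : Set Pt3))).Nonempty) with hF
  set U : Set Pt3 := ⋃ Q ∈ 𝓕, cv (Q : Set Pt3) with hU
  have hUc : IsClosed U := isClosed_biUnion_finset (fun Q _ => closed_hull Q)
  have hxU : x ∉ U := by
    intro hxU
    rw [hU] at hxU
    simp only [mem_iUnion] at hxU
    obtain ⟨Q, hQ, hxQ⟩ := hxU
    rw [hF, Finset.mem_filter, Finset.mem_powerset] at hQ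
    exact hcon Q hQ.1 hQ.2.1 hQ.2.2 hxQ
  have hxcl : x ∈ closure (interior (cv (W : Set Pt3))) := by
    rw [(convex_convexHull ℝ _).closure_interior_eq_closure_of_nonempty_interior hi]
    exact subset_closure hx
  have hne : (Uᶜ ∩ interior (cv (W : Set Pt3))).Nonempty :=
    mem_closure_iff.1 hxcl _ hUc.isOpen_compl hxU
  obtain ⟨z, hz, hzL⟩ := generic_pt (hUc.isOpen_compl.inter isOpen_interior) hne
    (s := {Q : Finset Pt3 | Q ∈ V.powerset ∧ affineSpan ℝ (Q : Set Pt3) ≠ ⊤})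
    (V.powerset.finite_toSet.subset (fun Q hQ => hQ.1))
    (fun Q => affineSpan ℝ (Q : Set Pt3)) (fun Q hQ => hQ.2)
  obtain ⟨Q, hQV, hR, hzQ⟩ := h z hz.2
  by_cases hd : (interior (cv (Q : Set Pt3))).Nonempty
  · apply hz.1
    rw [hU]
    simp only [mem_iUnion]
    exact ⟨Q, by rw [hF, Finset.mem_filter, Finset.mem_powerset]; exact ⟨hQV, hR, hd⟩, hzQ⟩
  · refine hzL Q ⟨Finset.mem_powerset.2 hQV, ?_⟩ (convexHull_subset_affineSpan _ hzQ)
    exact fun ht => hd (interior_convexHull_nonempty_iff_affineSpan_eq_top.2 ht)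

/-- The exit point of a ray. -/
theorem exit_pt {K : Set Pt3} (hK : IsCompact K) {u x : Pt3} (hx : x ∈ K) (hux : u ≠ x) :
    ∃ y ∈ K, y ∉ interior K ∧ x ∈ segment ℝ u y := by
  have hc : Continuous (fun t : ℝ => u + t • (x - u)) := by fun_prop
  have hxu : 0 < ‖x - u‖ := norm_pos_iff.2 (sub_ne_zero.2 hux.symm)
  obtain ⟨M, hM⟩ := hK.isBounded.exists_norm_le
  set A : Set ℝ := Icc 1 ((M + ‖u‖) / ‖x - u‖) ∩ (fun t : ℝ => u + t • (x - u)) ⁻¹' K with hA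
  have hAc : IsCompact A := isCompact_Icc.inter_right (hK.isClosed.preimage hc)
  have hbd : ∀ t : ℝ, 1 ≤ t → u + t • (x - u) ∈ K → t ∈ A := by
    intro t ht h
    refine ⟨⟨ht, ?_⟩, h⟩
    rw [le_div_iff₀ hxu]
    have h1 := hM _ h
    have h2 : ‖t • (x - u)‖ ≤ ‖u + t • (x - u)‖ + ‖u‖ := by
      have := norm_sub_le (u + t • (x - u)) u
      simpa using this
    rw [norm_smul, Real.norm_of_nonneg (by linarith)] at h2
    linarith
  have h1A : (1 : ℝ) ∈ A := hbd 1 le_rfl (by simpa using hx)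
  obtain ⟨t, htA, ht⟩ := hAc.exists_isMaxOn ⟨1, h1A⟩ continuous_id.continuousOn
  have ht1 : 1 ≤ t := htA.1.1
  refine ⟨u + t • (x - u), htA.2, ?_, ?_⟩
  · intro hnInt
    have hn : (fun t : ℝ => u + t • (x - u)) ⁻¹' (interior K) ∈ nhds t :=
      hc.continuousAt.preimage_mem_nhds (isOpen_interior.mem_nhds hnInt)
    obtain ⟨e, he, hb⟩ := Metric.mem_nhds_iff.1 hn
    have h2 : t + e / 2 ∈ Metric.ball t e := by
      rw [Metric.mem_ball, Real.dist_eq, add_sub_cancel_left, abs_of_pos (by positivity)]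
      linarith
    have h3 := ht (hbd (t + e / 2) (by linarith) (interior_subset (hb h2)))
    simp only [id] at h3
    have : t + e / 2 ≤ t := h3
    linarith
  · refine ⟨1 - 1 / t, 1 / t, ?_, by positivity, by ring, ?_⟩
    · rw [sub_nonneg, div_le_one (by linarith)]; exact ht1
    · have : t ≠ 0 := by linarith
      ext i
      simp
      field_simp
      ring

/-- Pulling at a vertex. -/
theorem pull {W : Finset Pt3} (hi : (interior (cv (W : Set Pt3))).Nonempty) {u : Pt3} (hu : u ∈ W)
    (hP : Pts (W : Set Pt3)) :
    ∀ x ∈ cv (W : Set Pt3), ∃ S ⊆ W, u ∉ S ∧ (S ≠ W) ∧ IsExtreme ℝ (cv (W : Set Pt3)) (cv (S : Set Pt3)) ∧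
      (interior (cv ((insert u S : Finset Pt3) : Set Pt3))).Nonempty ∧
      x ∈ cv ((insert u S : Finset Pt3) : Set Pt3) := by
  intro x hx
  have key := drop_deg (V := W) hi (R := fun Q => ∃ S ⊆ W, u ∉ S ∧ IsExtreme ℝ (cv (W : Set Pt3)) (cv (S : Set Pt3)) ∧
    Q = insert u S) (by
      intro z hz
      have hzK := interior_subset hz
      have hzu : u ≠ z := by
        rintro rfl
        have h1 := ext_interior (hP u hu) rfl hz
        have h2 := interior_mono h1 hz
        rw [interior_singleton] at h2
        exact h2
      obtain ⟨y, hyK, hyi, hzy⟩ := exit_pt (W.finite_toSet.isCompact_convexHull ℝ) hzK hzu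
      obtain ⟨f, hf1, w, hw, hfw⟩ := supp_pt (convex_convexHull ℝ _) hi hyi
      have hle : ∀ x ∈ (W : Set Pt3), f x ≤ f y := fun x hx => hf1 x (subset_convexHull ℝ _ hx)
      have hS : ((W.filter (fun x => f x = f y) : Finset Pt3) : Set Pt3) = {x | x ∈ (W : Set Pt3) ∧ f x = f y} := by
        ext; simp
      have hyS : y ∈ cv ((W.filter (fun x => f x = f y) : Finset Pt3) : Set Pt3) := by
        rw [hS, ← func_conv hle]; exact ⟨hyK, rfl⟩
      refine ⟨insert u (W.filter (fun x => f x = f y)),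
        Finset.insert_subset hu (Finset.filter_subset _ _),
        ⟨_, Finset.filter_subset _ _, ?_, ?_, rfl⟩, ?_⟩
      · intro h
        have hfu := (Finset.mem_filter.1 h).2
        obtain ⟨a, b, ha, hb, hab, rfl⟩ := hzy
        have hfz : f (a • u + b • y) = f y := by
          rw [aff_comb f hab, hfu, ← add_mul, hab, one_mul]
        have := ext_interior (func_ext0 hle) ⟨hzK, hfz⟩ hz hw
        exact hfw.ne this.2
      · rw [hS]; exact func_ext hle
      · refine (convex_convexHull ℝ _).segment_subset ?_ ?_ hzy
        · exact subset_convexHull ℝ _ (by simp)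
        · exact convexHull_mono (by simp) hyS) x hx
  obtain ⟨Q, hQ, ⟨S, hS, huS, hE, rfl⟩, hin, hxQ⟩ := key
  exact ⟨S, hS, huS, fun h => huS (h ▸ hu), hE, hin, hxQ⟩

/-- Intersections of cones over faces not containing the apex. -/
theorem cone_inter {K F F' : Set Pt3} (hK : Convex ℝ K) {u : Pt3} (huK : u ∈ K)
    (hF : IsExtreme ℝ K F) (hF' : IsExtreme ℝ K F') (hu : u ∉ F) (hu' : u ∉ F')
    {t t' : Finset Pt3} (ht : cv (t : Set Pt3) ⊆ F) (ht' : cv (t' : Set Pt3) ⊆ F')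
    (hI : cv (t : Set Pt3) ∩ cv (t' : Set Pt3) ⊆ cv ((t ∩ t' : Finset Pt3) : Set Pt3)) :
    cv ((insert u t : Finset Pt3) : Set Pt3) ∩ cv ((insert u t' : Finset Pt3) : Set Pt3) ⊆
      cv ((insert u (t ∩ t') : Finset Pt3) : Set Pt3) := by
  have seg : ∀ (s : Finset Pt3) z, z ∈ cv ((insert u s : Finset Pt3) : Set Pt3) →
      z = u ∨ ∃ y ∈ cv (s : Set Pt3), ∃ a : ℝ, 0 < a ∧ a ≤ 1 ∧ z = (1 - a) • u + a • y := by
    intro s z hz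
    rcases s.eq_empty_or_nonempty with rfl | hs
    · left; simpa using hz
    replace hz : z ∈ convexHull ℝ (insert u (s : Set Pt3)) := by
      rw [← Finset.coe_insert]; exact hz
    rw [convexHull_insert (by exact_mod_cast hs), mem_convexJoin] at hz
    obtain ⟨u', hu', y, hy, a, b, ha, hb, hab, rfl⟩ := hz
    obtain rfl : u' = u := hu'
    rcases hb.eq_or_lt with rfl | hb
    · left
      obtain rfl : a = 1 := by linarith
      simp
    · right
      refine ⟨y, hy, b, hb, by linarith, ?_⟩
      congr 2; linarith
  have main : ∀ (G : Set Pt3), IsExtreme ℝ K G → u ∉ G → ∀ y y' : Pt3, y ∈ K → y' ∈ G → ∀ a a' : ℝ,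
      0 < a → a < a' → (1 - a) • u + a • y = (1 - a') • u + a' • y' → False := by
    intro G hG huG y y' hy hy' a a' ha haa' h
    refine huG (hG.left_mem_of_mem_openSegment huK hy hy' ?_)
    have ha' : 0 < a' := ha.trans haa'
    refine ⟨1 - a / a', a / a', by rw [sub_pos, div_lt_one ha']; exact haa', by positivity, by ring, ?_⟩
    have hne := ha'.ne'
    ext i
    have := congrFun h i
    simp at this ⊢
    field_simp
    linarith
  rintro z ⟨hz, hz'⟩
  rcases seg _ _ hz with rfl | ⟨y, hy, a, ha, ha1, e⟩
  · exact subset_convexHull ℝ _ (by simp)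
  rcases seg _ _ hz' with rfl | ⟨y', hy', a', ha', ha1', e'⟩
  · exact subset_convexHull ℝ _ (by simp)
  rcases lt_trichotomy a a' with h | h | h
  · exact (main F' hF' hu' y y' (hF.subset (ht hy)) (ht' hy') a a' ha h (e.symm.trans e')).elim
  · subst h
    have hyy : y = y' := by
      have h2 := e.symm.trans e'
      rw [add_right_inj] at h2
      exact smul_right_injective _ ha.ne' h2
    subst hyy
    have h3 := hI ⟨hy, hy'⟩
    rw [e]
    refine (convex_convexHull ℝ _) (subset_convexHull ℝ _ (by simp))
      (convexHull_mono (by simp) h3) (by linarith) ha.le (by ring)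
  · exact (main F hF hu y' y (hF'.subset (ht' hy')) (ht hy) a' a ha' h (e'.symm.trans e)).elim

abbrev AI (F : Finset Pt3) : Prop := AffineIndependent ℝ (fun p : (F : Set Pt3) => (p : Pt3))

theorem AI_insert {F : Finset Pt3} (h : AI F) {u : Pt3} (hu : u ∉ affineSpan ℝ (F : Set Pt3)) :
    AI (insert u F) := by
  have huF : u ∉ F := fun h => hu (subset_affineSpan ℝ _ h)
  unfold AI
  have key : AffineIndependent ℝ (fun p : ((insert u F : Finset Pt3) : Set Pt3) => (p : Pt3)) := by
    refine AffineIndependent.affineIndependent_of_notMem_span (i := ⟨u, by simp⟩) ?_ ?_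
    · have hmem : ∀ q : {y : ((insert u F : Finset Pt3) : Set Pt3) // y ≠ ⟨u, by simp⟩}, (q.1 : Pt3) ∈ (F : Set Pt3) := by
        intro q
        have h1 := q.1.2
        have h2 := q.2
        simp only [Finset.coe_insert, Set.mem_insert_iff] at h1
        rcases h1 with h1 | h1
        · exact absurd (Subtype.ext h1) h2
        · exact h1
      exact AffineIndependent.comp_embedding (⟨fun q => ⟨(q.1 : Pt3), hmem q⟩, by
        intro q q' hqq
        simp only [Subtype.mk.injEq] at hqq
        exact Subtype.ext (Subtype.ext hqq)⟩ :
        {y : ((insert u F : Finset Pt3) : Set Pt3) // y ≠ ⟨u, by simp⟩} ↪ (F : Set Pt3)) h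
    · intro hmem
      apply hu
      refine affineSpan_mono ℝ ?_ hmem
      rintro x ⟨q, hq, rfl⟩
      have h1 := q.2
      simp only [Finset.coe_insert, Set.mem_insert_iff] at h1
      rcases h1 with h1 | h1
      · exact absurd (Subtype.ext h1) hq
      · exact h1
  exact key

theorem AI_mono {F G : Finset Pt3} (h : AI F) (hG : G ⊆ F) : AI G :=
  AffineIndependent.mono h (by exact_mod_cast hG)

theorem AI_single (a : Pt3) : AI {a} := by
  have : Subsingleton (({a} : Finset Pt3) : Set Pt3) := by
    simp
  exact affineIndependent_of_subsingleton ℝ _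

/-- Cutting a simple vertex `c` with neighbours `n1, n2, n3`. -/
def Cut (V : Finset Pt3) (c n1 n2 n3 : Pt3) : Prop :=
  ∃ l1 l2 l3 : Pt3 →ᵃ[ℝ] ℝ,
    (∀ y, y = c + (l1 y • (n1 - c) + l2 y • (n2 - c) + l3 y • (n3 - c))) ∧
    (∀ y ∈ V, 0 ≤ l1 y ∧ 0 ≤ l2 y ∧ 0 ≤ l3 y) ∧
    (∀ y ∈ V, y ≠ c → 1 ≤ l1 y + l2 y + l3 y) ∧
    (∀ y ∈ V, l1 y + l2 y + l3 y = 1 → y ∈ ({n1, n2, n3} : Finset Pt3)) ∧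
    (l1 c + l2 c + l3 c = 0) ∧ (∀ y ∈ ({n1, n2, n3} : Finset Pt3), l1 y + l2 y + l3 y = 1)

theorem tri_hull {n1 n2 n3 : Pt3} {a b c : ℝ} (ha : 0 ≤ a) (hb : 0 ≤ b) (hc : 0 ≤ c) (h : a + b + c = 1) :
    a • n1 + b • n2 + c • n3 ∈ cv (({n1, n2, n3} : Finset Pt3) : Set Pt3) := by
  have h1 := (convex_convexHull ℝ (({n1, n2, n3} : Finset Pt3) : Set Pt3)).sum_mem
    (t := Finset.univ) (w := ![a, b, c]) (z := ![n1, n2, n3])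
    (by intro i _; fin_cases i <;> simpa) (by simp [Fin.sum_univ_three, h])
    (by intro i _; apply subset_convexHull; fin_cases i <;> simp)
  simpa [Fin.sum_univ_three] using h1

theorem tet_hull {n0 n1 n2 n3 : Pt3} {a b c d : ℝ} (ha : 0 ≤ a) (hb : 0 ≤ b) (hc : 0 ≤ c) (hd : 0 ≤ d)
    (h : a + b + c + d = 1) :
    a • n0 + b • n1 + c • n2 + d • n3 ∈ cv (({n0, n1, n2, n3} : Finset Pt3) : Set Pt3) := by
  have h1 := (convex_convexHull ℝ (({n0, n1, n2, n3} : Finset Pt3) : Set Pt3)).sum_mem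
    (t := Finset.univ) (w := ![a, b, c, d]) (z := ![n0, n1, n2, n3])
    (by intro i _; fin_cases i <;> simpa) (by simp [Fin.sum_univ_four, h])
    (by intro i _; apply subset_convexHull; fin_cases i <;> simp)
  simpa [Fin.sum_univ_four] using h1

theorem aff_sub (f : Pt3 →ᵃ[ℝ] ℝ) (x y : Pt3) : f.linear (x - y) = f x - f y := by
  simpa using f.linearMap_vsub x y

theorem aff_rep (f : Pt3 →ᵃ[ℝ] ℝ) {c n1 n2 n3 y : Pt3} {a b d : ℝ}
    (h : y = c + (a • (n1 - c) + b • (n2 - c) + d • (n3 - c))) :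
    f y = f c + (a * (f n1 - f c) + b * (f n2 - f c) + d * (f n3 - f c)) := by
  have h1 : y - c = a • (n1 - c) + b • (n2 - c) + d • (n3 - c) := by rw [h]; abel
  have h2 := congrArg f.linear h1
  simp only [map_add, map_smul, aff_sub, smul_eq_mul] at h2
  linarith

theorem simple_cut {V : Finset Pt3} (hP : Pts (V : Set Pt3)) {c n1 n2 n3 : Pt3}
    (hc : c ∈ V) (h1 : n1 ∈ V) (h2 : n2 ∈ V) (h3 : n3 ∈ V)
    (f1 f2 f3 : Pt3 →ᵃ[ℝ] ℝ)
    (H1 : ∀ x ∈ V, f1 x ≤ f1 c) (H2 : ∀ x ∈ V, f2 x ≤ f2 c) (H3 : ∀ x ∈ V, f3 x ≤ f3 c)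
    (a11 : f1 n1 < f1 c) (a12 : f1 n2 = f1 c) (a13 : f1 n3 = f1 c)
    (a21 : f2 n1 = f2 c) (a22 : f2 n2 < f2 c) (a23 : f2 n3 = f2 c)
    (a31 : f3 n1 = f3 c) (a32 : f3 n2 = f3 c) (a33 : f3 n3 < f3 c) : Cut V c n1 n2 n3 := by
  have hli : LinearIndependent ℝ ![n1 - c, n2 - c, n3 - c] := by
    rw [Fintype.linearIndependent_iff]
    intro g hg
    simp only [Fin.sum_univ_three, Matrix.cons_val] at hg
    have e1 := congrArg f1.linear hg
    have e2 := congrArg f2.linear hg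
    have e3 := congrArg f3.linear hg
    simp only [map_add, map_smul, aff_sub, smul_eq_mul, map_zero, a12, a13, a21, a23, a31, a32, sub_self,
      mul_zero, add_zero, zero_add, mul_eq_zero] at e1 e2 e3
    intro i
    fin_cases i
    · exact e1.resolve_right (by linarith)
    · exact e2.resolve_right (by linarith)
    · exact e3.resolve_right (by linarith)
  have hspan := hli.span_eq_top_of_card_eq_finrank (by simp)
  have rep : ∀ y, ∃ a b d : ℝ, y = c + (a • (n1 - c) + b • (n2 - c) + d • (n3 - c)) := by
    intro y
    have : y - c ∈ Submodule.span ℝ (Set.range ![n1 - c, n2 - c, n3 - c]) := by rw [hspan]; trivial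
    rw [Submodule.mem_span_range_iff_exists_fun] at this
    obtain ⟨g, hg⟩ := this
    simp only [Fin.sum_univ_three, Matrix.cons_val] at hg
    exact ⟨g 0, g 1, g 2, by rw [hg]; abel⟩
  have d1 : f1 c - f1 n1 ≠ 0 := by linarith
  have d2 : f2 c - f2 n2 ≠ 0 := by linarith
  have d3 : f3 c - f3 n3 ≠ 0 := by linarith
  let l (f : Pt3 →ᵃ[ℝ] ℝ) (n : Pt3) : Pt3 →ᵃ[ℝ] ℝ := (f c - f n)⁻¹ • (AffineMap.const ℝ Pt3 (f c) - f)
  have hl : ∀ f n y, l f n y = (f c - f y) / (f c - f n) := by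
    intro f n y
    simp [l]
    rw [div_eq_inv_mul]
  have hrep : ∀ y, y = c + (l f1 n1 y • (n1 - c) + l f2 n2 y • (n2 - c) + l f3 n3 y • (n3 - c)) := by
    intro y
    obtain ⟨a, b, d, h⟩ := rep y
    have e1 := aff_rep f1 h
    have e2 := aff_rep f2 h
    have e3 := aff_rep f3 h
    rw [a12, a13] at e1
    rw [a21, a23] at e2
    rw [a31, a32] at e3
    have b1 : l f1 n1 y = a := by rw [hl, div_eq_iff d1]; linarith
    have b2 : l f2 n2 y = b := by rw [hl, div_eq_iff d2]; linarith
    have b3 : l f3 n3 y = d := by rw [hl, div_eq_iff d3]; linarith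
    rw [b1, b2, b3]; exact h
  have hpos : ∀ y ∈ V, 0 ≤ l f1 n1 y ∧ 0 ≤ l f2 n2 y ∧ 0 ≤ l f3 n3 y := by
    intro y hy
    have e1 := H1 y hy
    have e2 := H2 y hy
    have e3 := H3 y hy
    rw [hl, hl, hl]
    exact ⟨div_nonneg (by linarith) (by linarith), div_nonneg (by linarith) (by linarith),
      div_nonneg (by linarith) (by linarith)⟩
  have hone : ∀ y ∈ ({n1, n2, n3} : Finset Pt3), l f1 n1 y + l f2 n2 y + l f3 n3 y = 1 := by
    intro y hy
    simp only [Finset.mem_insert, Finset.mem_singleton] at hy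
    rw [hl, hl, hl]
    rcases hy with rfl | rfl | rfl
    · rw [a21, a31, div_self d1]; simp
    · rw [a12, a32, div_self d2]; simp
    · rw [a13, a23, div_self d3]; simp
  refine ⟨l f1 n1, l f2 n2, l f3 n3, hrep, hpos, ?_, ?_, by rw [hl, hl, hl]; simp, hone⟩
  · intro y hy hyc
    by_contra hlt
    push Not at hlt
    obtain ⟨p1, p2, p3⟩ := hpos y hy
    have hmem : y ∈ cv (({c, n1, n2, n3} : Finset Pt3) : Set Pt3) := by
      have := tet_hull (n0 := c) (n1 := n1) (n2 := n2) (n3 := n3)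
        (a := 1 - (l f1 n1 y + l f2 n2 y + l f3 n3 y)) (by linarith) p1 p2 p3 (by ring)
      convert this using 1
      conv_lhs => rw [hrep y]
      module
    have h5 := hP.mem (by
      intro x hx
      simp only [Finset.coe_insert, Finset.coe_singleton, Set.mem_insert_iff, Set.mem_singleton_iff] at hx
      rcases hx with rfl | rfl | rfl | rfl <;> assumption) hy hmem
    rw [Finset.mem_coe, Finset.mem_insert] at h5
    have := hone y (h5.resolve_left hyc)
    linarith
  · intro y hy hs
    obtain ⟨p1, p2, p3⟩ := hpos y hy
    have hmem : y ∈ cv (({n1, n2, n3} : Finset Pt3) : Set Pt3) := by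
      have := tri_hull (n1 := n1) (n2 := n2) (n3 := n3) p1 p2 p3 hs
      convert this using 1
      conv_lhs => rw [hrep y]
      have : c = (1 : ℝ) • c := by simp
      nth_rewrite 1 [this]
      rw [← hs]
      module
    exact hP.mem (by
      intro x hx
      simp only [Finset.coe_insert, Finset.coe_singleton, Set.mem_insert_iff, Set.mem_singleton_iff] at hx
      rcases hx with rfl | rfl | rfl <;> assumption) hy hmem

namespace Cut
variable {V : Finset Pt3} {c n1 n2 n3 : Pt3}

theorem ex_func (h : Cut V c n1 n2 n3) : ∃ L : Pt3 →ᵃ[ℝ] ℝ, L c = 1 ∧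
    (∀ y ∈ ({n1, n2, n3} : Finset Pt3), L y = 0) ∧ (∀ y ∈ V, y ≠ c → L y ≤ 0) ∧
    (∀ y ∈ V, L y = 0 → y ∈ ({n1, n2, n3} : Finset Pt3)) := by
  obtain ⟨l1, l2, l3, hrep, hpos, hge, heq, h0, hone⟩ := h
  have hv : ∀ y, (AffineMap.const ℝ Pt3 (1 : ℝ) - (l1 + l2 + l3)) y = 1 - (l1 y + l2 y + l3 y) := by
    intro y; simp
  refine ⟨AffineMap.const ℝ Pt3 (1 : ℝ) - (l1 + l2 + l3), ?_, ?_, ?_, ?_⟩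
  · rw [hv, h0]; simp
  · intro y hy; rw [hv, hone y hy]; simp
  · intro y hy hyc; rw [hv]; linarith [hge y hy hyc]
  · intro y hy h; rw [hv] at h; exact heq y hy (by linarith)

/-- Face-to-face property of the corner tetrahedron. -/
theorem inter (h : Cut V c n1 n2 n3) {τ : Finset Pt3} (hτ : τ ⊆ V) (hc : c ∉ τ) :
    cv (({c, n1, n2, n3} : Finset Pt3) : Set Pt3) ∩ cv (τ : Set Pt3) ⊆
      cv ((({n1, n2, n3} : Finset Pt3) ∩ τ : Finset Pt3) : Set Pt3) := by
  obtain ⟨L, hL1, hL0, hLle, hLeq⟩ := h.ex_func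
  rintro z ⟨hz, hz'⟩
  have hle : ∀ x ∈ (τ : Set Pt3), L x ≤ 0 := fun x hx => hLle x (hτ hx) (by rintro rfl; exact hc hx)
  have e1 := conv_le hle z hz'
  have e2 : 0 ≤ L z := conv_ge (c := 0) (f := L) (by
    intro x hx
    rw [Finset.mem_coe, Finset.mem_insert] at hx
    rcases hx with rfl | hx
    · rw [hL1]; norm_num
    · rw [hL0 x hx]) z hz
  have : z ∈ {x | x ∈ cv (τ : Set Pt3) ∧ L x = 0} := ⟨hz', le_antisymm e1 e2⟩
  rw [func_conv hle] at this
  refine convexHull_mono ?_ this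
  rintro x ⟨hx, hx0⟩
  rw [Finset.mem_coe, Finset.mem_inter]
  exact ⟨hLeq x (hτ hx) hx0, hx⟩

theorem face (h : Cut V c n1 n2 n3) {X : Finset Pt3} (hX : X ⊆ V) (hc : c ∉ X)
    (hN : ({n1, n2, n3} : Finset Pt3) ⊆ X) :
    IsExtreme ℝ (cv (X : Set Pt3)) (cv (({n1, n2, n3} : Finset Pt3) : Set Pt3)) := by
  obtain ⟨L, hL1, hL0, hLle, hLeq⟩ := h.ex_func
  have hle : ∀ x ∈ (X : Set Pt3), L x ≤ 0 := fun x hx => hLle x (hX hx) (by rintro rfl; exact hc hx)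
  have : (({n1, n2, n3} : Finset Pt3) : Set Pt3) = {x | x ∈ (X : Set Pt3) ∧ L x = 0} := by
    ext x
    constructor
    · intro hx; exact ⟨hN hx, hL0 x hx⟩
    · rintro ⟨hx, hx0⟩; exact hLeq x (hX hx) hx0
  rw [this]
  exact func_ext hle

/-- If a functional is larger at the cut vertex, its maximum on the rest is attained inside `N`. -/
theorem max_sub (h : Cut V c n1 n2 n3) {f : Pt3 →ᵃ[ℝ] ℝ} {b : ℝ} (hb : b < f c)
    (hn : ∀ y ∈ ({n1, n2, n3} : Finset Pt3), f y ≤ b) {y : Pt3} (hy : y ∈ V) (hyc : y ≠ c)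
    (hfy : f y = b) : y ∈ ({n1, n2, n3} : Finset Pt3) := by
  obtain ⟨l1, l2, l3, hrep, hpos, hge, heq, h0, hone⟩ := h
  obtain ⟨p1, p2, p3⟩ := hpos y hy
  have hs := hge y hy hyc
  have e := aff_rep f (hrep y)
  have m1 := hn n1 (by simp)
  have m2 := hn n2 (by simp)
  have m3 := hn n3 (by simp)
  refine heq y hy (le_antisymm ?_ hs)
  by_contra hlt
  push Not at hlt
  nlinarith [mul_nonneg p1 (sub_nonneg.2 m1), mul_nonneg p2 (sub_nonneg.2 m2), mul_nonneg p3 (sub_nonneg.2 m3),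
    mul_pos (sub_pos.2 hlt) (sub_pos.2 hb)]

theorem cover (h : Cut V c n1 n2 n3) {X : Finset Pt3} (hX : X ⊆ V)
    (hN : ({n1, n2, n3} : Finset Pt3) ⊆ X) (hc : c ∉ X) {x : Pt3}
    (hx : x ∈ cv ((insert c X : Finset Pt3) : Set Pt3)) :
    x ∈ cv (({c, n1, n2, n3} : Finset Pt3) : Set Pt3) ∨ x ∈ cv (X : Set Pt3) := by
  obtain ⟨l1, l2, l3, hrep, hpos, hge, heq, h0, hone⟩ := h
  have hXne : (X : Set Pt3).Nonempty := ⟨n1, hN (by simp)⟩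
  replace hx : x ∈ convexHull ℝ (insert c (X : Set Pt3)) := by
    rw [← Finset.coe_insert]; exact hx
  rw [convexHull_insert hXne, mem_convexJoin] at hx
  obtain ⟨c', hc', y, hy, a, s, ha, hs, has, rfl⟩ := hx
  obtain rfl : c' = c := hc'
  obtain rfl : a = 1 - s := by linarith
  have q1 : 0 ≤ l1 y := conv_ge (fun x hx => (hpos x (hX hx)).1) y hy
  have q2 : 0 ≤ l2 y := conv_ge (fun x hx => (hpos x (hX hx)).2.1) y hy
  have q3 : 0 ≤ l3 y := conv_ge (fun x hx => (hpos x (hX hx)).2.2) y hy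
  have qq : 1 ≤ l1 y + l2 y + l3 y := by
    have := conv_ge (f := l1 + l2 + l3) (c := 1) (V := (X : Set Pt3)) (by
      intro x hx
      exact hge x (hX hx) (by rintro rfl; exact hc hx)) y hy
    exact this
  set A := l1 y + l2 y + l3 y with hA
  have hApos : 0 < A := by linarith
  by_cases hsA : s * A ≤ 1
  · left
    have := tet_hull (n0 := c') (n1 := n1) (n2 := n2) (n3 := n3)
      (a := 1 - s * A) (b := s * l1 y) (c := s * l2 y) (d := s * l3 y)
      (by linarith) (by positivity) (by positivity) (by positivity) (by rw [hA]; ring)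
    convert this using 1
    conv_lhs => rw [hrep y]
    rw [hA]
    module
  · right
    push Not at hsA
    -- the point of the segment in the cutting plane
    have hn : (l1 y / A) • n1 + (l2 y / A) • n2 + (l3 y / A) • n3 ∈ cv (X : Set Pt3) := by
      refine convexHull_mono (by exact_mod_cast hN) (tri_hull (by positivity) (by positivity) (by positivity) ?_)
      rw [← add_div, ← add_div, ← hA, div_self hApos.ne']
    set q := (l1 y / A) • n1 + (l2 y / A) • n2 + (l3 y / A) • n3 with hq
    have hyq : y = (1 - A) • c' + A • q := by
      conv_lhs => rw [hrep y]
      rw [hq]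
      simp only [smul_add, smul_smul, mul_div_cancel₀ _ hApos.ne']
      rw [hA]
      module
    have hs1 : s ≤ 1 := by linarith
    rcases qq.eq_or_lt with h1 | h1
    · exfalso; rw [← h1] at hsA; linarith
    -- x = (1-r) q + r y
    have hr : (1 - s) • c' + s • y = (1 - (s * A - 1) / (A - 1)) • q + ((s * A - 1) / (A - 1)) • y := by
      have hne : A - 1 ≠ 0 := by linarith
      have e : (s * A - 1) / (A - 1) * (A - 1) = s * A - 1 := div_mul_cancel₀ _ hne
      set r := (s * A - 1) / (A - 1)
      rw [hyq]
      have e1 : (1 - s) + s * (1 - A) = r * (1 - A) := by linarith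
      have e2 : s * A = (1 - r) + r * A := by linarith
      calc (1 - s) • c' + s • ((1 - A) • c' + A • q) = ((1 - s) + s * (1 - A)) • c' + (s * A) • q := by module
        _ = _ := by rw [e1, e2]; module
    rw [hr]
    refine convex_convexHull ℝ _ hn hy ?_ ?_ (by ring)
    · rw [sub_nonneg, div_le_one (by linarith)]
      nlinarith
    · exact div_nonneg (by linarith) (by linarith)

end Cut

def pv (m i : ℕ) : ℕ := if i = 0 then m - 1 else i - 1

theorem interior_of_sub {V Q G : Finset Pt3} (hQV : Q ⊆ V)
    (hG : IsExtreme ℝ (cv (V : Set Pt3)) (cv (G : Set Pt3))) (hne : ¬ cv (V : Set Pt3) ⊆ cv (G : Set Pt3))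
    (hQ : Q ⊆ G) : ¬ (interior (cv (Q : Set Pt3))).Nonempty := by
  rintro ⟨z, hz⟩
  refine hne (ext_interior hG ?_ (interior_mono (convexHull_mono (by exact_mod_cast hQV)) hz))
  exact convexHull_mono (by exact_mod_cast hQ) (interior_subset hz)

namespace Prism

variable {m : ℕ} {V : Finset Pt3} {p : Bool → ℕ → Pt3}

theorem pv_lt (P : Prism m V p) {i : ℕ} (hi : i < m) : pv m i < m := by
  have := P.hm
  unfold pv; split_ifs <;> omega

theorem nx_pv (P : Prism m V p) {i : ℕ} (hi : i < m) : nx m (pv m i) = i := by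
  have := P.hm
  by_cases h : i = 0
  · have : pv m i = m - 1 := by simp [pv, h]
    rw [this, nx, if_pos (by omega), h]
  · have : pv m i = i - 1 := by simp [pv, h]
    rw [this, nx, if_neg (by omega)]; omega

theorem pv_ne (P : Prism m V p) {i : ℕ} (hi : i < m) : pv m i ≠ i ∧ pv m i ≠ nx m i := by
  have := P.hm
  unfold pv nx
  split_ifs <;> omega

theorem p_mem_side (P : Prism m V p) (b : Bool) {i j : ℕ} (hi : i < m) (hj : j < m) :
    p b j ∈ sideF p m i ↔ j = i ∨ j = nx m i := by
  have hn := P.nx_lt hi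
  constructor
  · intro h
    simp only [sideF, Finset.mem_insert, Finset.mem_singleton] at h
    rcases h with h | h | h | h
    · exact Or.inl (P.inj _ _ _ _ hj hi h).2
    · exact Or.inl (P.inj _ _ _ _ hj hi h).2
    · exact Or.inr (P.inj _ _ _ _ hj hn h).2
    · exact Or.inr (P.inj _ _ _ _ hj hn h).2
  · rintro (rfl | rfl) <;> cases b <;> simp [sideF]

theorem p_ne (P : Prism m V p) {b b' : Bool} {i j : ℕ} (hi : i < m) (hj : j < m) (h : b ≠ b' ∨ i ≠ j) :
    p b i ≠ p b' j := by
  intro e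
  have := P.inj _ _ _ _ hi hj e
  tauto

theorem notMem_span (P : Prism m V p) {G : Finset Pt3} (hG : G ⊆ V) (hne : G.Nonempty)
    (hE : IsExtreme ℝ (cv (V : Set Pt3)) (cv (G : Set Pt3))) {x : Pt3} (hx : x ∈ V) (hxG : x ∉ G) :
    x ∉ affineSpan ℝ (G : Set Pt3) := by
  intro h
  have h1 := span_face hE (by exact_mod_cast hne) (subset_convexHull ℝ _ hx) h
  exact hxG (P.pts.mem (by exact_mod_cast hG) hx h1)

theorem corner_tet (P : Prism m V p) (b : Bool) {i : ℕ} (hi : i < m) :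
    IsTet {p b i, p (!b) i, p b (pv m i), p b (nx m i)} := by
  have hn := P.nx_lt hi
  have hv := P.pv_lt hi
  obtain ⟨v1, v2⟩ := P.pv_ne hi
  have n1 := P.nx_ne (i := i)
  constructor
  · rw [Finset.card_insert_of_notMem, Finset.card_insert_of_notMem, Finset.card_insert_of_notMem,
      Finset.card_singleton]
    · simp only [Finset.mem_singleton]; exact P.p_ne hv hn (Or.inr v2)
    · simp only [Finset.mem_insert, Finset.mem_singleton, not_or]
      exact ⟨P.p_ne hi hv (Or.inl (by simp)), P.p_ne hi hn (Or.inl (by simp))⟩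
    · simp only [Finset.mem_insert, Finset.mem_singleton, not_or]
      exact ⟨P.p_ne hi hi (Or.inl (by simp)), P.p_ne hi hv (Or.inr v1.symm), P.p_ne hi hn (Or.inr n1.symm)⟩
  · have a1 : AI {p b i} := AI_single _
    have a2 : AI (insert (p b (nx m i)) {p b i}) := AI_insert a1 (by
      simp only [Finset.coe_singleton, AffineSubspace.mem_affineSpan_singleton]
      exact P.p_ne hn hi (Or.inr n1))
    have a3 := AI_insert a2 (u := p b (pv m i)) (by
      intro h
      refine P.notMem_span (P.side_sub hi) ⟨p false i, by simp [sideF]⟩ (P.side i hi) (P.p_mem b hv)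
        (fun h => ?_) (affineSpan_mono ℝ ?_ h)
      · rw [P.p_mem_side b hi hv] at h; tauto
      · intro x hx
        simp only [Finset.coe_insert, Finset.coe_singleton, Set.mem_insert_iff, Set.mem_singleton_iff] at hx
        rw [Finset.mem_coe]
        rcases hx with rfl | rfl
        · rw [P.p_mem_side b hi hn]; tauto
        · rw [P.p_mem_side b hi hi]; tauto)
    have a4 := AI_insert a3 (u := p (!b) i) (by
      intro h
      refine P.notMem_span (P.cap_sub b) ⟨p b i, (P.p_mem_cap b b hi).2 rfl⟩ (P.cap b) (P.p_mem (!b) hi)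
        (fun h => ?_) (affineSpan_mono ℝ ?_ h)
      · rw [P.p_mem_cap _ _ hi] at h; simp at h
      · intro x hx
        simp only [Finset.coe_insert, Finset.coe_singleton, Set.mem_insert_iff, Set.mem_singleton_iff] at hx
        rw [Finset.mem_coe]
        rcases hx with rfl | rfl | rfl
        · rw [P.p_mem_cap _ _ hv]
        · rw [P.p_mem_cap _ _ hn]
        · rw [P.p_mem_cap _ _ hi])
    refine AI_mono a4 ?_
    intro x hx
    simp only [Finset.mem_insert, Finset.mem_singleton] at hx ⊢
    tauto

theorem int_V (P : Prism m V p) : (interior (cv (V : Set Pt3))).Nonempty := by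
  have h0 : 0 < m := by have := P.hm; omega
  refine (tet_interior (P.corner_tet false h0)).mono (interior_mono (convexHull_mono ?_))
  intro x hx
  simp only [Finset.coe_insert, Finset.coe_singleton, Set.mem_insert_iff, Set.mem_singleton_iff] at hx
  rcases hx with rfl | rfl | rfl | rfl
  · exact P.p_mem _ h0
  · exact P.p_mem _ h0
  · exact P.p_mem _ (P.pv_lt h0)
  · exact P.p_mem _ (P.nx_lt h0)

/-- Every proper supporting functional has its maximal set inside a cap or side. -/
theorem func_complete (P : Prism m V p) {f : Pt3 →ᵃ[ℝ] ℝ} {c : ℝ} (h : ∀ x ∈ V, f x ≤ c)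
    (hlt : ∃ x ∈ V, f x < c) :
    (∃ b, ∀ x ∈ V, f x = c → x ∈ capF p m b) ∨ ∃ i < m, ∀ x ∈ V, f x = c → x ∈ sideF p m i := by
  have hS : ((V.filter (fun x => f x = c) : Finset Pt3) : Set Pt3) = {x | x ∈ (V : Set Pt3) ∧ f x = c} := by
    ext; simp
  have := P.complete (V.filter (fun x => f x = c)) (Finset.filter_subset _ _) (by
    intro e
    obtain ⟨x, hx, hf⟩ := hlt
    rw [← e, Finset.mem_filter] at hx
    linarith [hx.2]) (by rw [hS]; exact func_ext (by exact_mod_cast h))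
  rcases this with ⟨b, hb⟩ | ⟨i, hi, hb⟩
  · exact Or.inl ⟨b, fun x hx hf => hb (Finset.mem_filter.2 ⟨hx, hf⟩)⟩
  · exact Or.inr ⟨i, hi, fun x hx hf => hb (Finset.mem_filter.2 ⟨hx, hf⟩)⟩

theorem supp_V (P : Prism m V p) {G : Finset Pt3} (hG : G ⊆ V) (hne : G.Nonempty)
    (hE : IsExtreme ℝ (cv (V : Set Pt3)) (cv (G : Set Pt3))) (hp : ∃ x ∈ V, x ∉ G) :
    ∃ (f : Pt3 →ᵃ[ℝ] ℝ) (c : ℝ), (∀ x ∈ V, f x ≤ c) ∧ (∃ x ∈ V, f x < c) ∧ ∀ x ∈ G, f x = c := by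
  obtain ⟨f, c, h1, ⟨x, hx, hfx⟩, h3⟩ := supp_face (convex_convexHull ℝ _) P.int_V hE (by exact_mod_cast hne) (by
    intro h
    obtain ⟨x, hx, hxG⟩ := hp
    exact hxG (P.pts.mem (by exact_mod_cast hG) hx (h (subset_convexHull ℝ _ hx))))
  refine ⟨f, c, fun x hx => h1 x (subset_convexHull ℝ _ hx), ?_, h3⟩
  by_contra hcon
  push Not at hcon
  have := conv_ge (f := f) (c := c) (V := (V : Set Pt3)) hcon x hx
  linarith

theorem cap_func (P : Prism m V p) (b : Bool) : ∃ (f : Pt3 →ᵃ[ℝ] ℝ) (c : ℝ), (∀ x ∈ V, f x ≤ c) ∧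
    (∀ x ∈ V, f x = c ↔ x ∈ capF p m b) := by
  have hm := P.hm
  have h0 : 0 < m := by omega
  obtain ⟨f, c, h1, h2, h3⟩ := P.supp_V (P.cap_sub b) ⟨p b 0, (P.p_mem_cap b b h0).2 rfl⟩ (P.cap b)
    ⟨p (!b) 0, P.p_mem _ h0, by rw [P.p_mem_cap _ _ h0]; simp⟩
  refine ⟨f, c, h1, fun x hx => ⟨fun hf => ?_, fun h => h3 x h⟩⟩
  have hk : ∀ k < m, f (p b k) = c := fun k hk => h3 _ ((P.p_mem_cap b b hk).2 rfl)
  rcases P.func_complete h1 h2 with ⟨b', hb⟩ | ⟨i, hi, hb⟩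
  · have := (P.p_mem_cap _ _ h0).1 (hb _ (P.p_mem b h0) (hk 0 h0))
    subst this
    exact hb x hx hf
  · exfalso
    have h4 := (P.p_mem_side b hi (P.pv_lt hi)).1 (hb _ (P.p_mem b (P.pv_lt hi)) (hk _ (P.pv_lt hi)))
    have := P.pv_ne hi
    tauto

theorem side_func (P : Prism m V p) {i : ℕ} (hi : i < m) : ∃ (f : Pt3 →ᵃ[ℝ] ℝ) (c : ℝ), (∀ x ∈ V, f x ≤ c) ∧
    (∀ x ∈ V, f x = c ↔ x ∈ sideF p m i) := by
  have hm := P.hm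
  have hn := P.nx_lt hi
  have hv := P.pv_lt hi
  obtain ⟨v1, v2⟩ := P.pv_ne hi
  obtain ⟨f, c, h1, h2, h3⟩ := P.supp_V (P.side_sub hi) ⟨p false i, by simp [sideF]⟩ (P.side i hi)
    ⟨p false (pv m i), P.p_mem _ hv, by rw [P.p_mem_side _ hi hv]; tauto⟩
  refine ⟨f, c, h1, fun x hx => ⟨fun hf => ?_, fun h => h3 x h⟩⟩
  have hk : ∀ b, f (p b i) = c := fun b => h3 _ ((P.p_mem_side b hi hi).2 (Or.inl rfl))
  have hk' : ∀ b, f (p b (nx m i)) = c := fun b => h3 _ ((P.p_mem_side b hi hn).2 (Or.inr rfl))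
  rcases P.func_complete h1 h2 with ⟨b', hb⟩ | ⟨j, hj, hb⟩
  · have := (P.p_mem_cap _ _ hi).1 (hb _ (P.p_mem (!b') hi) (hk _))
    simp at this
  · have e1 := (P.p_mem_side false hj hi).1 (hb _ (P.p_mem _ hi) (hk _))
    have e2 := (P.p_mem_side false hj hn).1 (hb _ (P.p_mem _ hn) (hk' _))
    have : j = i := by
      have := P.nx_ne (i := i)
      rcases e1 with e1 | e1
      · exact e1.symm
      · rcases e2 with e2 | e2
        · exfalso
          rw [← e2] at e1
          apply v2
          unfold nx pv at *
          split_ifs at * <;> omega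
        · exact absurd (e2.trans e1.symm) this
    subst this
    exact hb x hx hf

/-- Every vertex of a prism is simple. -/
theorem cut (P : Prism m V p) (b : Bool) {i : ℕ} (hi : i < m) :
    Cut V (p b i) (p (!b) i) (p b (pv m i)) (p b (nx m i)) := by
  have hn := P.nx_lt hi
  have hv := P.pv_lt hi
  obtain ⟨v1, v2⟩ := P.pv_ne hi
  have n1 := P.nx_ne (i := i)
  obtain ⟨f1, c1, a1, a2⟩ := P.cap_func b
  obtain ⟨f2, c2, b1, b2⟩ := P.side_func hi
  obtain ⟨f3, c3, d1, d2⟩ := P.side_func hv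
  have m0 := P.p_mem b hi
  have m1 := P.p_mem (!b) hi
  have m2 := P.p_mem b hv
  have m3 := P.p_mem b hn
  have e1 := (a2 _ m0).2 ((P.p_mem_cap _ _ hi).2 rfl)
  have e2 := (b2 _ m0).2 ((P.p_mem_side _ hi hi).2 (Or.inl rfl))
  have e3 := (d2 _ m0).2 ((P.p_mem_side _ hv hi).2 (Or.inr (P.nx_pv hi).symm))
  refine simple_cut P.pts m0 m1 m2 m3 f1 f2 f3 (by rwa [e1]) (by rwa [e2]) (by rwa [e3])
    ?_ ?_ ?_ ?_ ?_ ?_ ?_ ?_ ?_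
  · rw [e1]
    refine lt_of_le_of_ne (a1 _ m1) (fun h => ?_)
    have := (P.p_mem_cap _ _ hi).1 ((a2 _ m1).1 h)
    simp at this
  · rw [e1, a2 _ m2, P.p_mem_cap _ _ hv]
  · rw [e1, a2 _ m3, P.p_mem_cap _ _ hn]
  · rw [e2, b2 _ m1, P.p_mem_side _ hi hi]; tauto
  · rw [e2]
    refine lt_of_le_of_ne (b1 _ m2) (fun h => ?_)
    have := (P.p_mem_side _ hi hv).1 ((b2 _ m2).1 h)
    tauto
  · rw [e2, b2 _ m3, P.p_mem_side _ hi hn]; tauto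
  · rw [e3, d2 _ m1, P.p_mem_side _ hv hi, P.nx_pv hi]; tauto
  · rw [e3, d2 _ m2, P.p_mem_side _ hv hv]; tauto
  · rw [e3]
    refine lt_of_le_of_ne (d1 _ m3) (fun h => ?_)
    have := (P.p_mem_side _ hv hn).1 ((d2 _ m3).1 h)
    rw [P.nx_pv hi] at this
    rcases this with h | h
    · exact v2 h.symm
    · exact n1 h

end Prism

def ev (i : ℕ) : Bool := decide (i % 2 = 1)

theorem ev_succ (i : ℕ) : ev (i + 1) = !ev i := by
  unfold ev
  rcases Nat.mod_two_eq_zero_or_one i with h | h <;> simp [Nat.add_mod, h]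

/-- neighbours of the cut vertex `p (ev i) i` -/
def nbF (p : Bool → ℕ → Pt3) (m i : ℕ) : Finset Pt3 :=
  {p (!ev i) i, p (ev i) (pv m i), p (ev i) (nx m i)}

def cutF (V : Finset Pt3) (p : Bool → ℕ → Pt3) (k : ℕ) : Finset Pt3 :=
  V \ (Finset.range k).image (fun i => p (ev i) i)

theorem ext_restrict {V G W : Set Pt3} (hP : Pts V) (hG : G ⊆ V) (hW : W ⊆ V)
    (hE : IsExtreme ℝ (cv V) (cv G)) : IsExtreme ℝ (cv W) (cv (W ∩ G)) := by
  refine ⟨convexHull_mono inter_subset_left, ?_⟩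
  intro x hx y hy z hz hs
  have := hE.left_mem_of_mem_openSegment (convexHull_mono hW hx) (convexHull_mono hW hy)
    (convexHull_mono inter_subset_right hz) hs
  exact hP.face hG hE hW hx this

namespace Prism

variable {m : ℕ} {V : Finset Pt3} {p : Bool → ℕ → Pt3}

theorem mem_cutF (P : Prism m V p) {k : ℕ} (hk : k ≤ m - 1) (b : Bool) {j : ℕ} (hj : j < m) :
    p b j ∈ cutF V p k ↔ k ≤ j ∨ b = !ev j := by
  unfold cutF
  rw [Finset.mem_sdiff]
  constructor
  · rintro ⟨_, h⟩
    by_contra hcon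
    push Not at hcon
    apply h
    rw [Finset.mem_image]
    refine ⟨j, Finset.mem_range.2 hcon.1, ?_⟩
    congr 1
    have := hcon.2
    cases b <;> cases h : ev j <;> simp_all
  · intro h
    refine ⟨P.p_mem b hj, ?_⟩
    rw [Finset.mem_image]
    rintro ⟨i, hi, e⟩
    rw [Finset.mem_range] at hi
    obtain ⟨e1, e2⟩ := P.inj _ _ _ _ (by omega) hj e
    subst e2
    rcases h with h | h
    · omega
    · rw [h] at e1; simp at e1

theorem cutF_sub (k : ℕ) : cutF V p k ⊆ V := Finset.sdiff_subset

theorem nb_sub (P : Prism m V p) {k i : ℕ} (hi : i < m - 1) (hk : k ≤ m - 1) : nbF p m i ⊆ cutF V p k := by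
  have hm := P.hm
  intro x hx
  simp only [nbF, Finset.mem_insert, Finset.mem_singleton] at hx
  rcases hx with rfl | rfl | rfl
  · rw [P.mem_cutF hk _ (by omega)]; simp
  · rw [P.mem_cutF hk _ (P.pv_lt (by omega))]
    by_cases h0 : i = 0
    · left; simp only [pv, h0, if_true]; exact hk
    · right
      have : pv m i = i - 1 := by simp [pv, h0]
      rw [this]
      have := ev_succ (i - 1)
      rw [Nat.sub_add_cancel (by omega)] at this
      exact this
  · have : nx m i = i + 1 := by simp [nx]; omega
    rw [this, P.mem_cutF hk _ (by omega), ev_succ]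
    simp

theorem cut_nb (P : Prism m V p) {i : ℕ} (hi : i < m - 1) :
    Cut V (p (ev i) i) (p (!ev i) i) (p (ev i) (pv m i)) (p (ev i) (nx m i)) := P.cut _ (by omega)

theorem cut_cover (P : Prism m V p) {k : ℕ} (hk : k ≤ m - 1) {x : Pt3} (hx : x ∈ cv (V : Set Pt3)) :
    (∃ i < k, x ∈ cv ((insert (p (ev i) i) (nbF p m i) : Finset Pt3) : Set Pt3)) ∨
      x ∈ cv (cutF V p k : Set Pt3) := by
  induction k with
  | zero => right; simpa [cutF] using hx
  | succ k ih =>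
    rcases ih (by omega) with ⟨i, hi, h⟩ | h
    · exact Or.inl ⟨i, by omega, h⟩
    · have hc : p (ev k) k ∉ cutF V p (k + 1) := by
        rw [P.mem_cutF hk _ (by omega)]; simp
      have : cutF V p k = insert (p (ev k) k) (cutF V p (k + 1)) := by
        unfold cutF
        rw [Finset.range_add_one, Finset.image_insert, Finset.sdiff_insert]
        rw [Finset.insert_erase]
        exact (P.mem_cutF (k := k) (by omega) _ (by omega)).2 (Or.inl le_rfl)
      rw [this] at h
      rcases (P.cut_nb (i := k) (by omega)).cover (cutF_sub _) (P.nb_sub (by omega) hk) hc h with h | h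
      · exact Or.inl ⟨k, by omega, h⟩
      · exact Or.inr h

theorem c_notMem (P : Prism m V p) {i : ℕ} (hi : i < m - 1) : p (ev i) i ∉ cutF V p (m - 1) := by
  rw [P.mem_cutF le_rfl _ (by omega)]
  simp; omega

theorem ptsW (P : Prism m V p) : Pts (cutF V p (m - 1) : Set Pt3) :=
  P.pts.mono (by exact_mod_cast cutF_sub _)

theorem nb_face (P : Prism m V p) {i : ℕ} (hi : i < m - 1) :
    IsExtreme ℝ (cv (cutF V p (m - 1) : Set Pt3)) (cv (nbF p m i : Set Pt3)) :=
  (P.cut_nb hi).face (cutF_sub _) (P.c_notMem hi) (P.nb_sub hi le_rfl)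

theorem corner (P : Prism m V p) {i : ℕ} (hi : i < m - 1) : IsTet (insert (p (ev i) i) (nbF p m i)) :=
  P.corner_tet (ev i) (i := i) (by omega)

theorem nb_card (P : Prism m V p) {i : ℕ} (hi : i < m - 1) : (nbF p m i).card = 3 := by
  have := (P.corner hi).1
  rw [Finset.card_insert_of_notMem] at this
  · omega
  · exact fun h => P.c_notMem hi (P.nb_sub hi le_rfl h)

theorem nb_AI (P : Prism m V p) {i : ℕ} (hi : i < m - 1) : AI (nbF p m i) :=
  AI_mono (P.corner hi).2 (Finset.subset_insert _ _)

theorem notMem_spanW (P : Prism m V p) {G : Finset Pt3} (hG : G ⊆ cutF V p (m - 1)) (hne : G.Nonempty)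
    (hE : IsExtreme ℝ (cv (cutF V p (m - 1) : Set Pt3)) (cv (G : Set Pt3))) {x : Pt3}
    (hx : x ∈ cutF V p (m - 1)) (hxG : x ∉ G) : x ∉ affineSpan ℝ (G : Set Pt3) := by
  intro h
  have h1 := span_face hE (by exact_mod_cast hne) (subset_convexHull ℝ _ hx) h
  exact hxG (P.ptsW.mem (by exact_mod_cast hG) hx h1)

theorem nb_tet (P : Prism m V p) {i : ℕ} (hi : i < m - 1) {x : Pt3} (hx : x ∈ cutF V p (m - 1))
    (hxN : x ∉ nbF p m i) : IsTet (insert x (nbF p m i)) := by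
  refine ⟨by rw [Finset.card_insert_of_notMem hxN, P.nb_card hi], AI_insert (P.nb_AI hi) ?_⟩
  exact P.notMem_spanW (P.nb_sub hi le_rfl) ⟨_, Finset.mem_insert_self _ _⟩ (P.nb_face hi) hx hxN

theorem last_mem (P : Prism m V p) (b : Bool) : p b (m - 1) ∈ cutF V p (m - 1) := by
  have := P.hm
  rw [P.mem_cutF le_rfl _ (by omega)]; simp

theorem mem_nb (P : Prism m V p) {i j : ℕ} {b : Bool} (hi : i < m - 1) (hj : j < m) :
    p b j ∈ nbF p m i ↔ (b = !ev i ∧ j = i) ∨ (b = ev i ∧ (j = pv m i ∨ j = nx m i)) := by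
  have hi' : i < m := by omega
  have hn := P.nx_lt hi'
  have hv := P.pv_lt hi'
  simp only [nbF, Finset.mem_insert, Finset.mem_singleton]
  constructor
  · rintro (h | h | h)
    · have := P.inj _ _ _ _ hj hi' h; tauto
    · have := P.inj _ _ _ _ hj hv h; tauto
    · have := P.inj _ _ _ _ hj hn h; tauto
  · rintro (⟨rfl, rfl⟩ | ⟨rfl, rfl | rfl⟩) <;> tauto

theorem int_W (P : Prism m V p) : (interior (cv (cutF V p (m - 1) : Set Pt3))).Nonempty := by
  have hm := P.hm
  have h0 : 0 < m - 1 := by omega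
  have ht := P.nb_tet h0 (P.last_mem true) (by
    rw [P.mem_nb h0 (by omega)]
    simp [ev]; omega)
  refine (tet_interior ht).mono (interior_mono (convexHull_mono ?_))
  exact_mod_cast Finset.insert_subset (P.last_mem true) (P.nb_sub h0 le_rfl)

theorem W_faces (P : Prism m V p) {S : Finset Pt3} (hS : S ⊆ cutF V p (m - 1)) (hne : S ≠ cutF V p (m - 1))
    (hE : IsExtreme ℝ (cv (cutF V p (m - 1) : Set Pt3)) (cv (S : Set Pt3))) :
    (∃ i < m - 1, S ⊆ nbF p m i) ∨ (∃ b, S ⊆ capF p m b) ∨ ∃ i < m, S ⊆ sideF p m i := by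
  rcases S.eq_empty_or_nonempty with rfl | hSn
  · exact Or.inr (Or.inl ⟨true, by simp⟩)
  obtain ⟨f, c, h1, ⟨x, hx, hfx⟩, h3⟩ := supp_face (convex_convexHull ℝ _) P.int_W hE (by exact_mod_cast hSn) (by
    intro h
    apply hne
    refine Finset.Subset.antisymm hS (fun x hx => ?_)
    exact P.ptsW.mem (by exact_mod_cast hS) hx (h (subset_convexHull ℝ _ hx)))
  have hW : ∀ x ∈ cutF V p (m - 1), f x ≤ c := fun x hx => h1 x (subset_convexHull ℝ _ hx)
  by_cases hV : ∀ x ∈ V, f x ≤ c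
  · right
    have := P.func_complete hV (by
      by_contra hcon
      push Not at hcon
      have := conv_ge (f := f) (c := c) (V := (V : Set Pt3)) hcon x
        (convexHull_mono (by exact_mod_cast cutF_sub _) hx)
      linarith)
    rcases this with ⟨b, hb⟩ | ⟨i, hi, hb⟩
    · exact Or.inl ⟨b, fun x hx => hb x (cutF_sub _ (hS hx)) (h3 x hx)⟩
    · exact Or.inr ⟨i, hi, fun x hx => hb x (cutF_sub _ (hS hx)) (h3 x hx)⟩
  · left
    push Not at hV
    obtain ⟨v, hv, hfv⟩ := hV
    have hvW : v ∉ cutF V p (m - 1) := fun h => absurd (hW v h) (by linarith)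
    have : v ∈ (Finset.range (m - 1)).image (fun i => p (ev i) i) := by
      by_contra h
      exact hvW (Finset.mem_sdiff.2 ⟨hv, h⟩)
    rw [Finset.mem_image] at this
    obtain ⟨i, hi, rfl⟩ := this
    rw [Finset.mem_range] at hi
    refine ⟨i, hi, fun y hy => ?_⟩
    refine (P.cut_nb hi).max_sub hfv (fun y hy => hW y (P.nb_sub hi le_rfl hy)) (cutF_sub _ (hS hy)) ?_ (h3 y hy)
    rintro rfl
    exact P.c_notMem hi (hS hy)

end Prism

namespace Prism

variable {m : ℕ} {V : Finset Pt3} {p : Bool → ℕ → Pt3}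

/-- bases of the cone from `u` -/
def Base (p : Bool → ℕ → Pt3) (m : ℕ) (t : Finset Pt3) : Prop :=
  (∃ i < m - 1, p false (m - 1) ∉ nbF p m i ∧ t = nbF p m i) ∨
  (∃ i < m - 1, ev i = true ∧ p true (m - 1) ∉ nbF p m i ∧
    t = insert (p true (m - 1)) (nbF p m i ∩ capF p m true))

theorem top_face (P : Prism m V p) : IsExtreme ℝ (cv (cutF V p (m - 1) : Set Pt3))
    (cv ((cutF V p (m - 1) ∩ capF p m true : Finset Pt3) : Set Pt3)) := by
  rw [Finset.coe_inter]
  exact ext_restrict P.pts (by exact_mod_cast P.cap_sub true) (by exact_mod_cast cutF_sub _) (P.cap true)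

theorem u_notMem_top (P : Prism m V p) : p false (m - 1) ∉ capF p m true := by
  have := P.hm
  rw [P.p_mem_cap _ _ (by omega)]; simp

theorem nb_top (P : Prism m V p) {i : ℕ} (hi : i < m - 1) (he : ev i = true) :
    nbF p m i ∩ capF p m true = {p true (pv m i), p true (nx m i)} := by
  have hi' : i < m := by omega
  have hn := P.nx_lt hi'
  have hv := P.pv_lt hi'
  ext x
  simp only [nbF, Finset.mem_inter, Finset.mem_insert, Finset.mem_singleton, he]
  constructor
  · rintro ⟨rfl | rfl | rfl, h⟩
    · rw [P.p_mem_cap _ _ hi'] at h; simp at h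
    · tauto
    · tauto
  · rintro (rfl | rfl)
    · rw [P.p_mem_cap _ _ hv]; tauto
    · rw [P.p_mem_cap _ _ hn]; tauto

theorem base_face (P : Prism m V p) {t : Finset Pt3} (ht : Base p m t) :
    ∃ F ⊆ cutF V p (m - 1), IsExtreme ℝ (cv (cutF V p (m - 1) : Set Pt3)) (cv (F : Set Pt3)) ∧
      p false (m - 1) ∉ F ∧ t ⊆ F := by
  have hm := P.hm
  rcases ht with ⟨i, hi, hu, rfl⟩ | ⟨i, hi, he, hu, rfl⟩
  · exact ⟨_, P.nb_sub hi le_rfl, P.nb_face hi, hu, Finset.Subset.refl _⟩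
  · refine ⟨_, Finset.inter_subset_left, P.top_face, ?_, ?_⟩
    · intro h
      exact P.u_notMem_top (Finset.mem_inter.1 h).2
    · apply Finset.insert_subset
      · rw [Finset.mem_inter, P.p_mem_cap _ _ (by omega)]
        exact ⟨P.last_mem true, rfl⟩
      · exact Finset.inter_subset_inter_right (P.nb_sub hi le_rfl)

theorem base_tet (P : Prism m V p) {t : Finset Pt3} (ht : Base p m t) :
    IsTet (insert (p false (m - 1)) t) := by
  have hm := P.hm
  obtain ⟨F, hF, hFE, huF, htF⟩ := P.base_face ht
  have hut : p false (m - 1) ∉ t := fun h => huF (htF h)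
  rcases ht with ⟨i, hi, hu, rfl⟩ | ⟨i, hi, he, hu, rfl⟩
  · exact P.nb_tet hi (P.last_mem false) hu
  · have hu2 : p true (m - 1) ∉ nbF p m i ∩ capF p m true := fun h => hu (Finset.mem_inter.1 h).1
    have hne : (nbF p m i ∩ capF p m true).Nonempty := by rw [P.nb_top hi he]; exact ⟨_, Finset.mem_insert_self _ _⟩
    constructor
    · rw [Finset.card_insert_of_notMem hut, Finset.card_insert_of_notMem hu2, P.nb_top hi he,
        Finset.card_insert_of_notMem, Finset.card_singleton]
      rw [Finset.mem_singleton]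
      exact P.p_ne (P.pv_lt (by omega)) (P.nx_lt (by omega)) (Or.inr (P.pv_ne (by omega)).2)
    · refine AI_insert (AI_insert (AI_mono (P.nb_AI hi) Finset.inter_subset_left) ?_) ?_
      · intro h
        exact P.notMem_spanW (P.nb_sub hi le_rfl) ⟨_, Finset.mem_insert_self _ _⟩ (P.nb_face hi)
          (P.last_mem true) hu (affineSpan_mono ℝ (by exact_mod_cast Finset.inter_subset_left) h)
      · intro h
        exact P.notMem_spanW hF ⟨_, htF (Finset.mem_insert_self _ _)⟩ hFE
          (P.last_mem false) huF (affineSpan_mono ℝ (by exact_mod_cast htF) h)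

theorem notMem_cvW (P : Prism m V p) {F : Finset Pt3} (hF : F ⊆ cutF V p (m - 1)) {x : Pt3}
    (hx : x ∈ cutF V p (m - 1)) (hxF : x ∉ F) : x ∉ cv (F : Set Pt3) :=
  fun h => hxF (P.ptsW.mem (by exact_mod_cast hF) hx h)

theorem nb_inter (P : Prism m V p) {i : ℕ} (hi : i < m - 1) {t : Finset Pt3} (ht : t ⊆ cutF V p (m - 1)) :
    cv (nbF p m i : Set Pt3) ∩ cv (t : Set Pt3) ⊆ cv ((nbF p m i ∩ t : Finset Pt3) : Set Pt3) := by
  rintro z ⟨h1, h2⟩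
  have := P.ptsW.face (by exact_mod_cast P.nb_sub hi le_rfl) (P.nb_face hi) (by exact_mod_cast ht) h2 h1
  rw [Finset.inter_comm, Finset.coe_inter]
  exact this

theorem base_inter (P : Prism m V p) {t t' : Finset Pt3} (ht : Base p m t) (ht' : Base p m t') :
    cv (t : Set Pt3) ∩ cv (t' : Set Pt3) ⊆ cv ((t ∩ t' : Finset Pt3) : Set Pt3) := by
  have hm := P.hm
  obtain ⟨F, hF, hFE, huF, htF⟩ := P.base_face ht
  obtain ⟨F', hF', hFE', huF', htF'⟩ := P.base_face ht'
  rcases ht with ⟨i, hi, hu, rfl⟩ | ⟨i, hi, he, hu, rfl⟩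
  · exact P.nb_inter hi (htF'.trans hF')
  rcases ht' with ⟨j, hj, hu', rfl⟩ | ⟨j, hj, he', hu', rfl⟩
  · rw [inter_comm, Finset.inter_comm _ (nbF p m j)]
    exact P.nb_inter hj (htF.trans hF)
  · have := cone_inter (convex_convexHull ℝ _) (subset_convexHull ℝ _ (P.last_mem true))
      (P.nb_face hi) (P.nb_face hj) (P.notMem_cvW (P.nb_sub hi le_rfl) (P.last_mem true) hu)
      (P.notMem_cvW (P.nb_sub hj le_rfl) (P.last_mem true) hu')
      (t := nbF p m i ∩ capF p m true) (t' := nbF p m j ∩ capF p m true)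
      (convexHull_mono (by exact_mod_cast Finset.inter_subset_left))
      (convexHull_mono (by exact_mod_cast Finset.inter_subset_left)) (by
        rintro z ⟨h1, h2⟩
        have h3 := P.nb_inter hi (t := nbF p m j ∩ capF p m true)
          (Finset.inter_subset_left.trans (P.nb_sub hj le_rfl))
          ⟨convexHull_mono (by exact_mod_cast Finset.inter_subset_left) h1, h2⟩
        refine convexHull_mono ?_ h3
        intro x hx
        simp only [Finset.mem_coe, Finset.mem_inter] at hx ⊢
        tauto)
    refine this.trans (convexHull_mono ?_)
    intro x hx
    simp only [Finset.mem_coe, Finset.mem_inter, Finset.mem_insert] at hx ⊢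
    tauto

/-- The pieces of the minimal triangulation. -/
def Piece (p : Bool → ℕ → Pt3) (m : ℕ) (σ : Finset Pt3) : Prop :=
  (∃ i < m - 1, σ = insert (p (ev i) i) (nbF p m i)) ∨ ∃ t, Base p m t ∧ σ = insert (p false (m - 1)) t

theorem piece_tet (P : Prism m V p) {σ : Finset Pt3} (h : Piece p m σ) : IsTet σ := by
  rcases h with ⟨i, hi, rfl⟩ | ⟨t, ht, rfl⟩
  · exact P.corner hi
  · exact P.base_tet ht

theorem base_sub (P : Prism m V p) {t : Finset Pt3} (ht : Base p m t) :
    insert (p false (m - 1)) t ⊆ cutF V p (m - 1) := by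
  obtain ⟨F, hF, hFE, huF, htF⟩ := P.base_face ht
  exact Finset.insert_subset (P.last_mem false) (htF.trans hF)

theorem piece_sub (P : Prism m V p) {σ : Finset Pt3} (h : Piece p m σ) : σ ⊆ V := by
  rcases h with ⟨i, hi, rfl⟩ | ⟨t, ht, rfl⟩
  · exact Finset.insert_subset (P.p_mem _ (by omega)) ((P.nb_sub hi le_rfl).trans (cutF_sub _))
  · exact (P.base_sub ht).trans (cutF_sub _)

theorem corner_inter (P : Prism m V p) {i : ℕ} (hi : i < m - 1) {τ : Finset Pt3} (hτ : τ ⊆ V)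
    (hc : p (ev i) i ∉ τ) :
    cv ((insert (p (ev i) i) (nbF p m i) : Finset Pt3) : Set Pt3) ∩ cv (τ : Set Pt3) ⊆
    cv ((insert (p (ev i) i) (nbF p m i) ∩ τ : Finset Pt3) : Set Pt3) :=
  ((P.cut_nb hi).inter hτ hc).trans (convexHull_mono
    (by exact_mod_cast Finset.inter_subset_inter_right (Finset.subset_insert _ _)))

theorem piece_inter (P : Prism m V p) {σ τ : Finset Pt3} (h : Piece p m σ) (h' : Piece p m τ) :
    cv (σ : Set Pt3) ∩ cv (τ : Set Pt3) = cv ((σ ∩ τ : Finset Pt3) : Set Pt3) := by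
  apply Subset.antisymm
  swap
  · exact subset_inter (convexHull_mono (by exact_mod_cast Finset.inter_subset_left))
      (convexHull_mono (by exact_mod_cast Finset.inter_subset_right))
  have hσV := P.piece_sub h
  have hτV := P.piece_sub h'
  rcases h with ⟨i, hi, rfl⟩ | ⟨t, ht, rfl⟩
  · by_cases hc : p (ev i) i ∈ τ
    · rcases h' with ⟨j, hj, rfl⟩ | ⟨t, ht, rfl⟩
      · rw [Finset.mem_insert] at hc
        rcases hc with hc | hc
        · have := (P.inj _ _ _ _ (by omega) (by omega) hc).2
          subst this
          simp
        · exact absurd (P.nb_sub hj le_rfl hc) (P.c_notMem hi)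
      · exact absurd (P.base_sub ht hc) (P.c_notMem hi)
    · exact P.corner_inter hi hτV hc
  · rcases h' with ⟨j, hj, rfl⟩ | ⟨t', ht', rfl⟩
    · rw [inter_comm, Finset.inter_comm]
      exact P.corner_inter hj hσV (fun h => P.c_notMem hj (P.base_sub ht h))
    · obtain ⟨F, hF, hFE, huF, htF⟩ := P.base_face ht
      obtain ⟨F', hF', hFE', huF', htF'⟩ := P.base_face ht'
      have := cone_inter (convex_convexHull ℝ _) (subset_convexHull ℝ _ (P.last_mem false))
        hFE hFE' (P.notMem_cvW hF (P.last_mem false) huF) (P.notMem_cvW hF' (P.last_mem false) huF')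
        (convexHull_mono (by exact_mod_cast htF)) (convexHull_mono (by exact_mod_cast htF'))
        (P.base_inter ht ht')
      rw [← Finset.insert_inter_distrib]
      exact this

/-- side faces of `W` away from a last vertex are small -/
theorem side_small (P : Prism m V p) {S : Finset Pt3} (b : Bool) (hS : S ⊆ cutF V p (m - 1))
    (hb : p b (m - 1) ∉ S) {i : ℕ} (hi : i < m) (hSi : S ⊆ sideF p m i) : S.card ≤ 2 := by
  have hn := P.nx_lt hi
  let q : ℕ → Pt3 := fun j => if j = m - 1 then p (!b) j else p (!ev j) j
  have key : ∀ b' j, j < m → p b' j ∈ S → p b' j = q j := by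
    intro b' j hj h
    by_cases h1 : j = m - 1
    · simp only [q, h1, if_true]
      congr 1
      rw [h1] at h
      cases b <;> cases b' <;> simp_all
    · simp only [q, h1, if_false]
      have := (P.mem_cutF le_rfl _ hj).1 (hS h)
      rw [this.resolve_left (by omega)]
  have hsub : S ⊆ {q i, q (nx m i)} := by
    intro x hx
    have h := hSi hx
    simp only [sideF, Finset.mem_insert, Finset.mem_singleton] at h ⊢
    rcases h with rfl | rfl | rfl | rfl
    · exact Or.inl (key _ _ hi hx)
    · exact Or.inl (key _ _ hi hx)
    · exact Or.inr (key _ _ hn hx)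
    · exact Or.inr (key _ _ hn hx)
  exact (Finset.card_le_card hsub).trans Finset.card_le_two

theorem side_top_small (P : Prism m V p) {S : Finset Pt3} (hS : S ⊆ cutF V p (m - 1))
    (hb : p true (m - 1) ∉ S) {i : ℕ} (hi : i < m) (hSi : S ⊆ sideF p m i) :
    (S ∩ capF p m true).card ≤ 1 := by
  have hn := P.nx_lt hi
  rw [Finset.card_le_one]
  have key : ∀ x ∈ S ∩ capF p m true, ∃ j < m - 1, (j = i ∨ j = nx m i) ∧ ev j = false ∧ x = p true j := by
    intro x hx
    rw [Finset.mem_inter, mem_cap] at hx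
    obtain ⟨hxS, j, hj, rfl⟩ := hx
    have h1 := (P.p_mem_side _ hi hj).1 (hSi hxS)
    have h2 : j ≠ m - 1 := by rintro rfl; exact hb hxS
    have h3 := ((P.mem_cutF le_rfl _ hj).1 (hS hxS)).resolve_left (by omega)
    refine ⟨j, by omega, h1, ?_, rfl⟩
    cases h : ev j
    · rfl
    · rw [h] at h3; simp at h3
  intro x hx y hy
  obtain ⟨j, hj, h1, h2, rfl⟩ := key x hx
  obtain ⟨k, hk, h3, h4, rfl⟩ := key y hy
  have hev : ev (nx m i) = false → ev i = false → nx m i < m - 1 → i < m - 1 → False := by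
    intro a1 a2 a3 a4
    have : nx m i = i + 1 := by simp [nx]; omega
    rw [this, ev_succ, a2] at a1
    simp at a1
  rcases h1 with rfl | rfl <;> rcases h3 with rfl | rfl
  · rfl
  · exact (hev h4 h2 hk hj).elim
  · exact (hev h2 h4 hj hk).elim
  · rfl

theorem base_cover (P : Prism m V p) {x : Pt3} (hx : x ∈ cv (cutF V p (m - 1) : Set Pt3)) :
    ∃ t, Base p m t ∧ x ∈ cv ((insert (p false (m - 1)) t : Finset Pt3) : Set Pt3) := by
  have hm := P.hm
  set W := cutF V p (m - 1) with hW
  set u := p false (m - 1) with hu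
  set u' := p true (m - 1) with hu'
  have huW : u ∈ W := P.last_mem false
  have huW' : u' ∈ W := P.last_mem true
  have hsmall : ∀ Q : Finset Pt3, Q.card ≤ 3 → ¬ (interior (cv (Q : Set Pt3))).Nonempty := by
    intro Q hQ h
    rw [interior_small hQ] at h
    exact Set.not_nonempty_empty h
  have main := drop_deg (V := W) P.int_W (R := fun Q => (∃ t, Base p m t ∧ Q ⊆ insert u t) ∨ Q.card ≤ 3) (by
    intro z hz
    obtain ⟨S, hSW, huS, hSne, hSE, hnInt, hzS⟩ := pull P.int_W huW P.ptsW z (interior_subset hz)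
    have hSuW : insert u S ⊆ W := Finset.insert_subset huW hSW
    rcases P.W_faces hSW hSne hSE with ⟨i, hi, hSi⟩ | ⟨b, hSb⟩ | ⟨i, hi, hSi⟩
    · refine ⟨insert u S, hSuW, ?_, hzS⟩
      by_cases hui : u ∈ nbF p m i
      · right
        exact (Finset.card_le_card (Finset.insert_subset hui hSi)).trans (P.nb_card hi).le
      · left
        exact ⟨_, Or.inl ⟨i, hi, hui, rfl⟩, Finset.insert_subset_insert _ hSi⟩
    · cases b
      · exfalso
        refine interior_of_sub (hSuW.trans (cutF_sub _)) (P.cap false) (P.cap_proper false) ?_ hnInt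
        exact Finset.insert_subset ((P.p_mem_cap _ _ (by omega)).2 rfl) hSb
      · -- pull again at `u'`
        have hyz : ∃ S' : Finset Pt3, S' ⊆ W ∧ z ∈ cv ((insert u (insert u' (S' ∩ capF p m true)) : Finset Pt3) : Set Pt3) ∧
            ((∃ i < m - 1, S' ⊆ nbF p m i) ∨ (S' ∩ capF p m true).card ≤ 1) := by
          have hy : ∀ y ∈ cv (S : Set Pt3), ∃ S' : Finset Pt3, S' ⊆ W ∧ y ∈ cv ((insert u' (S' ∩ capF p m true) : Finset Pt3) : Set Pt3) ∧
              ((∃ i < m - 1, S' ⊆ nbF p m i) ∨ (S' ∩ capF p m true).card ≤ 1) := by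
            intro y hy
            have hyW : y ∈ cv (W : Set Pt3) := convexHull_mono (by exact_mod_cast hSW) hy
            have hytop : y ∈ cv (capF p m true : Set Pt3) := convexHull_mono (by exact_mod_cast hSb) hy
            obtain ⟨S', hSW', huS', hSne', hSE', hnInt', hyS'⟩ := pull P.int_W huW' P.ptsW y hyW
            have hSuW' : insert u' S' ⊆ W := Finset.insert_subset huW' hSW'
            have hut : u' ∈ capF p m true := (P.p_mem_cap _ _ (by omega)).2 rfl
            have hyF := P.pts.face (by exact_mod_cast P.cap_sub true) (P.cap true)
              (by exact_mod_cast hSuW'.trans (cutF_sub _)) hyS' hytop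
            rw [← Finset.coe_inter, Finset.insert_inter_of_mem hut] at hyF
            refine ⟨S', hSW', hyF, ?_⟩
            rcases P.W_faces hSW' hSne' hSE' with ⟨i, hi, hSi⟩ | ⟨b, hSb⟩ | ⟨i, hi, hSi⟩
            · exact Or.inl ⟨i, hi, hSi⟩
            · cases b
              · right
                rw [Finset.card_eq_zero.2]
                · omega
                · rw [← Finset.disjoint_iff_inter_eq_empty, Finset.disjoint_left]
                  intro x hx hx'
                  obtain ⟨j, hj, rfl⟩ := mem_cap.1 hx'
                  have := (P.p_mem_cap _ _ hj).1 (hSb hx)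
                  simp at this
              · exfalso
                refine interior_of_sub (hSuW'.trans (cutF_sub _)) (P.cap true) (P.cap_proper true) ?_ hnInt'
                exact Finset.insert_subset hut hSb
            · exact Or.inr (P.side_top_small hSW' huS' hi hSi)
          rcases S.eq_empty_or_nonempty with rfl | hSn
          · exfalso
            exact hsmall _ (by simp) hnInt
          · have hzS' : z ∈ convexHull ℝ (insert u (S : Set Pt3)) := by
              rw [← Finset.coe_insert]; exact hzS
            rw [convexHull_insert (by exact_mod_cast hSn), mem_convexJoin] at hzS'
            obtain ⟨u1, hu1, y, hyS, hzy⟩ := hzS'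
            obtain rfl : u1 = u := hu1
            obtain ⟨S', h1, h2, h3⟩ := hy y hyS
            refine ⟨S', h1, ?_, h3⟩
            refine (convex_convexHull ℝ _).segment_subset (subset_convexHull ℝ _ ?_) (convexHull_mono ?_ h2) hzy
            · simp
            · exact_mod_cast Finset.subset_insert _ _
        obtain ⟨S', hSW', hzS', hcase⟩ := hyz
        refine ⟨_, Finset.insert_subset huW (Finset.insert_subset huW' (Finset.inter_subset_left.trans hSW')), ?_, hzS'⟩
        rcases hcase with ⟨i, hi, hSi⟩ | hcard
        · have hsub : S' ∩ capF p m true ⊆ nbF p m i ∩ capF p m true := Finset.inter_subset_inter_right hSi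
          cases he : ev i
          · right
            have hsub2 : S' ∩ capF p m true ⊆ {p true i} := by
              intro x hx
              have := hsub hx
              rw [Finset.mem_inter, mem_cap] at this
              obtain ⟨h1, j, hj, rfl⟩ := this
              rw [P.mem_nb hi hj, he] at h1
              simp at h1
              simp [h1]
            have h1 := Finset.card_le_card hsub2
            have h2 := Finset.card_insert_le u' (S' ∩ capF p m true)
            have h3 := Finset.card_insert_le u (insert u' (S' ∩ capF p m true))
            rw [Finset.card_singleton] at h1
            omega
          · by_cases hui : u' ∈ nbF p m i
            · right
              have hsub2 : insert u' (S' ∩ capF p m true) ⊆ nbF p m i ∩ capF p m true := by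
                refine Finset.insert_subset (Finset.mem_inter.2 ⟨hui, (P.p_mem_cap _ _ (by omega)).2 rfl⟩) hsub
              rw [P.nb_top hi he] at hsub2
              have h1 := (Finset.card_le_card hsub2).trans Finset.card_le_two
              have h3 := Finset.card_insert_le u (insert u' (S' ∩ capF p m true))
              omega
            · left
              exact ⟨_, Or.inr ⟨i, hi, he, hui, rfl⟩,
                Finset.insert_subset_insert _ (Finset.insert_subset_insert _ hsub)⟩
        · right
          have h2 := Finset.card_insert_le u' (S' ∩ capF p m true)
          have h3 := Finset.card_insert_le u (insert u' (S' ∩ capF p m true))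
          omega
    · refine ⟨insert u S, hSuW, Or.inr ?_, hzS⟩
      have h1 := P.side_small false hSW huS hi hSi
      have h2 := Finset.card_insert_le u S
      omega) x hx
  obtain ⟨Q, hQ, h | h, hnInt, hxQ⟩ := main
  · obtain ⟨t, ht, hQt⟩ := h
    exact ⟨t, ht, convexHull_mono (by exact_mod_cast hQt) hxQ⟩
  · exact absurd hnInt (hsmall Q h)

theorem upper (P : Prism m V p) : ∃ T, IsTriangulation V T ∧ T.card ≤ 2 * m - 5 + (m + 1) / 2 := by
  have hm := P.hm
  set u := p false (m - 1) with hu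
  set u' := p true (m - 1) with hu'
  let T1 := (Finset.range (m - 1)).image (fun i => insert (p (ev i) i) (nbF p m i))
  let I2 := (Finset.range (m - 1)).filter (fun i => u ∉ nbF p m i)
  let T2 := I2.image (fun i => insert u (nbF p m i))
  let I3 := (Finset.range (m - 1)).filter (fun i => ev i = true ∧ u' ∉ nbF p m i)
  let T3 := I3.image (fun i => insert u (insert u' (nbF p m i ∩ capF p m true)))
  have hmem : ∀ σ, σ ∈ T1 ∪ T2 ∪ T3 ↔ Piece p m σ := by
    intro σ
    simp only [T1, T2, T3, I2, I3, Finset.mem_union, Finset.mem_image, Finset.mem_filter, Finset.mem_range]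
    constructor
    · rintro ((⟨i, hi, rfl⟩ | ⟨i, ⟨hi, h⟩, rfl⟩) | ⟨i, ⟨hi, h, h2⟩, rfl⟩)
      · exact Or.inl ⟨i, hi, rfl⟩
      · exact Or.inr ⟨_, Or.inl ⟨i, hi, h, rfl⟩, rfl⟩
      · exact Or.inr ⟨_, Or.inr ⟨i, hi, h, h2, rfl⟩, rfl⟩
    · rintro (⟨i, hi, rfl⟩ | ⟨t, ⟨i, hi, h, rfl⟩ | ⟨i, hi, h, h2, rfl⟩, rfl⟩)
      · exact Or.inl (Or.inl ⟨i, hi, rfl⟩)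
      · exact Or.inl (Or.inr ⟨i, ⟨hi, h⟩, rfl⟩)
      · exact Or.inr ⟨i, ⟨hi, h, h2⟩, rfl⟩
  refine ⟨T1 ∪ T2 ∪ T3, ⟨⟨?_, ?_, ?_⟩, ?_⟩, ?_⟩
  · intro σ hσ
    rw [hmem] at hσ
    exact ⟨P.piece_tet hσ, by exact_mod_cast P.piece_sub hσ⟩
  · intro σ hσ τ hτ hne
    rw [hmem] at hσ hτ
    exact interior_disj (P.piece_tet hσ) (P.piece_tet hτ) hne (P.piece_inter hσ hτ)
  · apply Subset.antisymm
    · refine iUnion₂_subset (fun σ hσ => convexHull_mono ?_)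
      rw [hmem] at hσ
      exact_mod_cast P.piece_sub hσ
    · intro x hx
      simp only [mem_iUnion, hmem]
      rcases P.cut_cover le_rfl hx with ⟨i, hi, h⟩ | h
      · exact ⟨_, Or.inl ⟨i, hi, rfl⟩, h⟩
      · obtain ⟨t, ht, h⟩ := P.base_cover h
        exact ⟨_, Or.inr ⟨t, ht, rfl⟩, h⟩
  · intro σ hσ τ hτ
    rw [hmem] at hσ hτ
    exact P.piece_inter hσ hτ
  · have c1 : T1.card ≤ m - 1 := Finset.card_image_le.trans (by simp)
    have c2 : T2.card ≤ 2 * ((m - 1) / 2) - 1 := by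
      refine Finset.card_image_le.trans ?_
      have : I2 ⊆ Finset.Ico 1 (2 * ((m - 1) / 2)) := by
        intro i hi
        simp only [I2, Finset.mem_filter, Finset.mem_range] at hi
        obtain ⟨hi, h⟩ := hi
        rw [P.mem_nb hi (by omega)] at h
        rw [Finset.mem_Ico]
        constructor
        · by_contra h0
          obtain rfl : i = 0 := by omega
          exact h (Or.inr ⟨by simp [ev], Or.inl (by simp [pv])⟩)
        · by_contra h0
          have e1 : i = m - 2 := by omega
          have e2 : i % 2 = 0 := by omega
          refine h (Or.inr ⟨by simp [ev, e2], Or.inr ?_⟩)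
          rw [nx, if_neg (by omega)]; omega
      have := Finset.card_le_card this
      rwa [Nat.card_Ico] at this
    have c3 : T3.card ≤ m / 2 - 1 := by
      refine Finset.card_image_le.trans ?_
      have hI : ∀ i ∈ I3, i % 2 = 1 ∧ i < m - 2 := by
        intro i hi
        simp only [I3, Finset.mem_filter, Finset.mem_range] at hi
        obtain ⟨hi, he, h⟩ := hi
        rw [P.mem_nb hi (by omega)] at h
        refine ⟨by simpa [ev] using he, ?_⟩
        by_contra h0
        refine h (Or.inr ⟨he.symm, Or.inr ?_⟩)
        rw [nx, if_neg (by omega)]; omega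
      have := Finset.card_le_card_of_injOn (s := I3) (t := Finset.range (m / 2 - 1)) (fun i => i / 2) (by
        intro i hi
        have := hI i hi
        rw [Finset.mem_coe, Finset.mem_range]
        change i / 2 < _
        omega) (by
        intro i hi j hj h
        have h1 := hI i hi
        have h2 := hI j hj
        simp only at h
        omega)
      rwa [Finset.card_range] at this
    have d1 := Finset.card_union_le (T1 ∪ T2) T3
    have d2 := Finset.card_union_le T1 T2
    omega

end Prism

def ang (m i : ℕ) : ℝ := 2 * Real.pi * i / m

def stdP (m : ℕ) (b : Bool) (i : ℕ) : Pt3 :=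
  ![Real.cos (ang m i), Real.sin (ang m i), if b then 1 else 0]

def fnl (α β γ : ℝ) : Pt3 →ᵃ[ℝ] ℝ :=
  (α • LinearMap.proj (R := ℝ) (φ := fun _ : Fin 3 => ℝ) 0 + β • LinearMap.proj (R := ℝ) (φ := fun _ : Fin 3 => ℝ) 1 +
    γ • LinearMap.proj (R := ℝ) (φ := fun _ : Fin 3 => ℝ) 2 : Pt3 →ₗ[ℝ] ℝ).toAffineMap

theorem fnl_apply (α β γ : ℝ) (x : Pt3) : fnl α β γ x = α * x 0 + β * x 1 + γ * x 2 := by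
  simp [fnl]

theorem fnl_std (φ γ : ℝ) (m : ℕ) (b : Bool) (i : ℕ) :
    fnl (Real.cos φ) (Real.sin φ) γ (stdP m b i) = Real.cos (φ - ang m i) + γ * (if b then 1 else 0) := by
  rw [fnl_apply, Real.cos_sub]
  simp [stdP]

theorem aff_form (f : Pt3 →ᵃ[ℝ] ℝ) : ∃ k α β γ : ℝ, ∀ x : Pt3, f x = k + (α * x 0 + β * x 1 + γ * x 2) := by
  refine ⟨f 0, f.linear (Pi.single 0 1), f.linear (Pi.single 1 1), f.linear (Pi.single 2 1), fun x => ?_⟩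
  have h1 := aff_sub f x 0
  have h2 : x - 0 = x 0 • (Pi.single 0 1 : Pt3) + x 1 • (Pi.single 1 1 : Pt3) + x 2 • (Pi.single 2 1 : Pt3) := by
    ext i
    fin_cases i <;> simp
  rw [h2, map_add, map_add, map_smul, map_smul, map_smul] at h1
  simp only [smul_eq_mul] at h1
  linarith

theorem stdBot_eq (m : ℕ) : stdBot m = capF (stdP m) m false := by
  ext x
  simp only [stdBot, capF, Finset.mem_image, Finset.mem_univ, true_and, Finset.mem_range, stdP, ang]
  constructor
  · rintro ⟨k, rfl⟩; exact ⟨k, k.2, by simp⟩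
  · rintro ⟨k, hk, rfl⟩; exact ⟨⟨k, hk⟩, by simp⟩

theorem stdTop_eq (m : ℕ) : stdPrismTop m = capF (stdP m) m true := by
  ext x
  simp only [stdPrismTop, capF, Finset.mem_image, Finset.mem_univ, true_and, Finset.mem_range, stdP, ang]
  constructor
  · rintro ⟨k, rfl⟩; exact ⟨k, k.2, by simp⟩
  · rintro ⟨k, hk, rfl⟩; exact ⟨⟨k, hk⟩, by simp⟩

theorem ang_lt {m i j : ℕ} (hi : i < m) : ang m i - ang m j < 2 * Real.pi := by
  have hm : (0 : ℝ) < m := by exact_mod_cast (by omega : 0 < m)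
  have h1 : (i : ℝ) < m := by exact_mod_cast hi
  have h2 : (0 : ℝ) ≤ j := by positivity
  unfold ang
  rw [← sub_div, div_lt_iff₀ hm]
  nlinarith [Real.pi_pos]

theorem ang_inj {m i j : ℕ} (hm : 0 < m) (h : ang m i = ang m j) : i = j := by
  have hm : (0 : ℝ) < m := by exact_mod_cast hm
  unfold ang at h
  rw [div_left_inj' hm.ne'] at h
  have := mul_left_cancel₀ (by positivity) h
  exact_mod_cast this

theorem cos_one {m i j : ℕ} (hi : i < m) (hj : j < m) (h : Real.cos (ang m i - ang m j) = 1) : i = j := by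
  have h1 := ang_lt (j := j) hi
  have h2 := ang_lt (j := i) hj
  rw [Real.cos_eq_one_iff_of_lt_of_lt (by linarith) h1] at h
  exact ang_inj (m := m) (by omega) (by linarith)

theorem std_inj {m : ℕ} {b b' : Bool} {i j : ℕ} (hi : i < m) (hj : j < m) (h : stdP m b i = stdP m b' j) :
    b = b' ∧ i = j := by
  constructor
  · have := congrFun h 2
    simp [stdP] at this
    cases b <;> cases b' <;> simp_all
  · have h1 := fnl_std (ang m i) 0 m b i
    rw [h, fnl_std] at h1
    simp at h1
    exact cos_one hi hj h1

theorem mem_std {m : ℕ} {x : Pt3} : x ∈ stdBot m ∪ stdPrismTop m ↔ ∃ b, ∃ i < m, stdP m b i = x := by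
  rw [stdBot_eq, stdTop_eq]
  simp [capF]

theorem std_pts (m : ℕ) : Pts ((stdBot m ∪ stdPrismTop m : Finset Pt3) : Set Pt3) := by
  intro x hx
  obtain ⟨b, i, hi, rfl⟩ := mem_std.1 (Finset.mem_coe.1 hx)
  set γ : ℝ := if b then 1 else -1 with hγ
  set f := fnl (Real.cos (ang m i)) (Real.sin (ang m i)) γ
  have hf : ∀ b' k, f (stdP m b' k) = Real.cos (ang m i - ang m k) + γ * (if b' then 1 else 0) :=
    fun b' k => fnl_std _ _ _ _ _
  set c : ℝ := 1 + (if b then 1 else 0) with hc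
  have hle : ∀ y ∈ ((stdBot m ∪ stdPrismTop m : Finset Pt3) : Set Pt3), f y ≤ c := by
    intro y hy
    obtain ⟨b', k, hk, rfl⟩ := mem_std.1 (Finset.mem_coe.1 hy)
    rw [hf]
    have := Real.cos_le_one (ang m i - ang m k)
    rw [hγ, hc]
    cases b <;> cases b' <;> simp <;> linarith
  have := func_ext hle
  convert this using 1
  have hset : {x | x ∈ ((stdBot m ∪ stdPrismTop m : Finset Pt3) : Set Pt3) ∧ f x = c} = {stdP m b i} := by
    ext y
    constructor
    · rintro ⟨hy, hfy⟩
      obtain ⟨b', k, hk, rfl⟩ := mem_std.1 (Finset.mem_coe.1 hy)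
      rw [hf] at hfy
      have h1 := Real.cos_le_one (ang m i - ang m k)
      have h2 : b' = b ∧ Real.cos (ang m i - ang m k) = 1 := by
        rw [hγ, hc] at hfy
        cases b <;> cases b' <;> simp at hfy ⊢ <;> linarith
      obtain ⟨rfl, h2⟩ := h2
      rw [cos_one hi hk h2]
      rfl
    · rintro rfl
      refine ⟨mem_std.2 ⟨b, i, hi, rfl⟩, ?_⟩
      rw [hf, hγ, hc]
      cases b <;> simp
  rw [hset]
  exact (convexHull_singleton _).symm

theorem std_cap {m : ℕ} (b : Bool) : IsExtreme ℝ (cv ((stdBot m ∪ stdPrismTop m : Finset Pt3) : Set Pt3))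
    (cv (capF (stdP m) m b : Set Pt3)) := by
  set f := fnl 0 0 (if b then 1 else -1)
  have hf : ∀ b' k, f (stdP m b' k) = (if b then 1 else -1) * (if b' then 1 else 0) := by
    intro b' k
    rw [fnl_apply]; simp [stdP]
  set c : ℝ := if b then 1 else 0 with hc
  have hle : ∀ y ∈ ((stdBot m ∪ stdPrismTop m : Finset Pt3) : Set Pt3), f y ≤ c := by
    intro y hy
    obtain ⟨b', k, hk, rfl⟩ := mem_std.1 (Finset.mem_coe.1 hy)
    rw [hf, hc]
    cases b <;> cases b' <;> simp
  convert func_ext hle using 2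
  ext y
  constructor
  · intro hy
    obtain ⟨i, hi, rfl⟩ := Prism.mem_cap.1 (Finset.mem_coe.1 hy)
    refine ⟨mem_std.2 ⟨b, i, hi, rfl⟩, ?_⟩
    rw [hf, hc]; cases b <;> simp
  · rintro ⟨hy, hfy⟩
    obtain ⟨b', k, hk, rfl⟩ := mem_std.1 (Finset.mem_coe.1 hy)
    rw [hf, hc] at hfy
    have : b' = b := by cases b <;> cases b' <;> simp at hfy ⊢
    subst this
    exact Finset.mem_coe.2 (Prism.mem_cap.2 ⟨k, hk, rfl⟩)

theorem cos_odd {m : ℕ} (hm : 3 ≤ m) {n : ℤ} (h1 : 1 ≤ n) (h2 : n ≤ m) :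
    Real.cos (n * (Real.pi / m)) ≤ Real.cos (Real.pi / m) ∧
    (Real.cos (n * (Real.pi / m)) = Real.cos (Real.pi / m) → n = 1) := by
  have hm0 : (0 : ℝ) < m := by exact_mod_cast (by omega : 0 < m)
  have hpos : 0 < Real.pi / m := by positivity
  have h1' : (1 : ℝ) ≤ n := by exact_mod_cast h1
  have h2' : (n : ℝ) ≤ m := by exact_mod_cast h2
  have hle : n * (Real.pi / m) ≤ Real.pi := by
    rw [mul_div_assoc', div_le_iff₀ hm0, mul_comm]
    exact mul_le_mul_of_nonneg_left h2' Real.pi_pos.le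
  have hge : Real.pi / m ≤ n * (Real.pi / m) := by nlinarith
  refine ⟨Real.cos_le_cos_of_nonneg_of_le_pi hpos.le hle hge, fun h => ?_⟩
  have := Real.injOn_cos ⟨by nlinarith, hle⟩ ⟨hpos.le, by linarith⟩ h
  have h3 : (n : ℝ) = 1 := by
    have h4 : ((n : ℝ) - 1) * (Real.pi / m) = 0 := by linarith
    rcases mul_eq_zero.1 h4 with h | h
    · linarith
    · linarith
  exact_mod_cast h3

theorem std_side {m : ℕ} (hm : 3 ≤ m) {i : ℕ} (hi : i < m) :
    IsExtreme ℝ (cv ((stdBot m ∪ stdPrismTop m : Finset Pt3) : Set Pt3))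
    (cv (sideF (stdP m) m i : Set Pt3)) := by
  have hm0 : (0 : ℝ) < m := by exact_mod_cast (by omega : 0 < m)
  set φ : ℝ := (2 * i + 1) * (Real.pi / m) with hφ
  set f := fnl (Real.cos φ) (Real.sin φ) 0
  have hf : ∀ b' k, f (stdP m b' k) = Real.cos (((2 * (i : ℤ) + 1 - 2 * k : ℤ) : ℝ) * (Real.pi / m)) := by
    intro b' k
    rw [fnl_std, zero_mul, add_zero]
    congr 1
    rw [hφ, ang]
    push_cast
    field_simp
  have key : ∀ k < m, Real.cos (((2 * (i : ℤ) + 1 - 2 * k : ℤ) : ℝ) * (Real.pi / m)) ≤ Real.cos (Real.pi / m) ∧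
      (Real.cos (((2 * (i : ℤ) + 1 - 2 * k : ℤ) : ℝ) * (Real.pi / m)) = Real.cos (Real.pi / m) ↔
        k = i ∨ k = nx m i) := by
    intro k hk
    set n : ℤ := 2 * (i : ℤ) + 1 - 2 * k with hn
    have hred : ∃ n' : ℤ, 1 ≤ n' ∧ n' ≤ m ∧ Real.cos ((n : ℝ) * (Real.pi / m)) = Real.cos ((n' : ℝ) * (Real.pi / m)) ∧
        (n' = n ∨ n' = -n ∨ n' = 2 * m - n ∨ n' = 2 * m + n) := by
      have hper : ∀ z : ℤ, Real.cos (((2 * m - z : ℤ) : ℝ) * (Real.pi / m)) = Real.cos ((z : ℝ) * (Real.pi / m)) := by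
        intro z
        have : ((2 * m - z : ℤ) : ℝ) * (Real.pi / m) = 2 * Real.pi - z * (Real.pi / m) := by
          push_cast; field_simp
        rw [this, Real.cos_two_pi_sub]
      have hneg : ∀ z : ℤ, Real.cos (((-z : ℤ) : ℝ) * (Real.pi / m)) = Real.cos ((z : ℝ) * (Real.pi / m)) := by
        intro z
        push_cast
        rw [neg_mul, Real.cos_neg]
      rcases le_or_gt n 0 with h0 | h0
      · rcases le_or_gt (-n) m with h | h
        · exact ⟨-n, by omega, h, (hneg n).symm, by tauto⟩
        · refine ⟨2 * m - (-n), by omega, by omega, ?_, by omega⟩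
          rw [hper, hneg]
      · rcases le_or_gt n m with h | h
        · exact ⟨n, by omega, h, rfl, by tauto⟩
        · exact ⟨2 * m - n, by omega, by omega, (hper n).symm, by tauto⟩
    obtain ⟨n', a1, a2, a3, a4⟩ := hred
    obtain ⟨b1, b2⟩ := cos_odd hm a1 a2
    rw [a3]
    refine ⟨b1, fun h => ?_, fun h => ?_⟩
    · have := b2 h
      unfold nx
      split_ifs <;> omega
    · rw [← a3]
      rcases h with h | h
      · have : n = 1 := by omega
        rw [this]; simp
      · unfold nx at h
        split_ifs at h with h'
        · have : (n : ℝ) * (Real.pi / m) = 2 * Real.pi - Real.pi / m := by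
            have e : n = 2 * m - 1 := by omega
            rw [e]; push_cast; field_simp
          rw [this, Real.cos_two_pi_sub]
        · have : n = -1 := by omega
          rw [this]; simp
  have hle : ∀ y ∈ ((stdBot m ∪ stdPrismTop m : Finset Pt3) : Set Pt3), f y ≤ Real.cos (Real.pi / m) := by
    intro y hy
    obtain ⟨b', k, hk, rfl⟩ := mem_std.1 (Finset.mem_coe.1 hy)
    rw [hf]; exact (key k hk).1
  have hn : nx m i < m := by unfold nx; split_ifs <;> omega
  convert func_ext hle using 2
  ext y
  constructor
  · intro hy
    have : ∃ b k, k < m ∧ (k = i ∨ k = nx m i) ∧ y = stdP m b k := by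
      simp only [sideF, Finset.mem_coe, Finset.mem_insert, Finset.mem_singleton] at hy
      rcases hy with rfl | rfl | rfl | rfl
      · exact ⟨_, _, hi, Or.inl rfl, rfl⟩
      · exact ⟨_, _, hi, Or.inl rfl, rfl⟩
      · exact ⟨_, _, hn, Or.inr rfl, rfl⟩
      · exact ⟨_, _, hn, Or.inr rfl, rfl⟩
    obtain ⟨b, k, hk, hki, rfl⟩ := this
    refine ⟨mem_std.2 ⟨b, k, hk, rfl⟩, ?_⟩
    rw [hf]; exact (key k hk).2.2 hki
  · rintro ⟨hy, hfy⟩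
    obtain ⟨b', k, hk, rfl⟩ := mem_std.1 (Finset.mem_coe.1 hy)
    rw [hf] at hfy
    rcases (key k hk).2.1 hfy with rfl | rfl <;> cases b' <;> simp [sideF]

theorem std_int {m : ℕ} (hm : 3 ≤ m) :
    (interior (cv ((stdBot m ∪ stdPrismTop m : Finset Pt3) : Set Pt3))).Nonempty := by
  have hm0 : (0 : ℝ) < m := by exact_mod_cast (by omega : 0 < m)
  have hm3 : (3 : ℝ) ≤ m := by exact_mod_cast hm
  set A : Set Pt3 := ((stdBot m ∪ stdPrismTop m : Finset Pt3) : Set Pt3) with hA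
  have hmem : ∀ b i, i < m → stdP m b i ∈ A := fun b i hi => mem_std.2 ⟨b, i, hi, rfl⟩
  rw [interior_convexHull_nonempty_iff_affineSpan_eq_top,
    AffineSubspace.affineSpan_eq_top_iff_vectorSpan_eq_top_of_nonempty ℝ Pt3 Pt3 ⟨_, hmem true 0 (by omega)⟩]
  set t := ang m 1 with ht
  have ht0 : 0 < t := by rw [ht, ang]; positivity
  have htpi : t < Real.pi := by
    rw [ht, ang, div_lt_iff₀ hm0]; push_cast; nlinarith [Real.pi_pos]
  have hs : 0 < Real.sin t := Real.sin_pos_of_pos_of_lt_pi ht0 htpi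
  have hc : Real.cos t - 1 < 0 := by
    have : Real.cos t ≠ 1 := by
      rw [Ne, Real.cos_eq_one_iff_of_lt_of_lt (by linarith) (by linarith)]; linarith
    have := lt_of_le_of_ne (Real.cos_le_one t) this
    linarith
  have e0 : ang m 0 = 0 := by simp [ang]
  have e1 : ang m (m - 1) = 2 * Real.pi - t := by
    rw [ht, ang, ang, Nat.cast_sub (by omega)]; push_cast; field_simp
  have v1 := vsub_mem_vectorSpan ℝ (hmem true 0 (by omega)) (hmem false 0 (by omega))
  have v2 := vsub_mem_vectorSpan ℝ (hmem false 1 (by omega)) (hmem false 0 (by omega))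
  have v3 := vsub_mem_vectorSpan ℝ (hmem false (m - 1) (by omega)) (hmem false 0 (by omega))
  rw [eq_top_iff]
  intro x _
  have hx : x = x 2 • (stdP m true 0 -ᵥ stdP m false 0) +
      ((x 0 / (2 * (Real.cos t - 1)) + x 1 / (2 * Real.sin t)) • (stdP m false 1 -ᵥ stdP m false 0) +
      (x 0 / (2 * (Real.cos t - 1)) - x 1 / (2 * Real.sin t)) • (stdP m false (m - 1) -ᵥ stdP m false 0)) := by
    have hc' := hc.ne
    have hs' := hs.ne'
    ext i
    fin_cases i
    · simp [stdP, e0, e1, ← ht, Real.cos_two_pi_sub]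
      field_simp
      ring
    · simp [stdP, e0, e1, ← ht, Real.sin_two_pi_sub]
      field_simp
      ring
    · simp [stdP]
  rw [hx]
  exact Submodule.add_mem _ (Submodule.smul_mem _ _ v1)
    (Submodule.add_mem _ (Submodule.smul_mem _ _ v2) (Submodule.smul_mem _ _ v3))

theorem max_adj {m : ℕ} {α β C : ℝ}
    (hle : ∀ j < m, α * Real.cos (ang m j) + β * Real.sin (ang m j) ≤ C)
    (hst : ∃ j < m, α * Real.cos (ang m j) + β * Real.sin (ang m j) < C)
    {k l : ℕ} (hkl : k < l) (hl : l < m)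
    (hk1 : α * Real.cos (ang m k) + β * Real.sin (ang m k) = C)
    (hl1 : α * Real.cos (ang m l) + β * Real.sin (ang m l) = C) :
    l = k + 1 ∨ (k = 0 ∧ l + 1 = m) := by
  have hm0 : (0 : ℝ) < m := by exact_mod_cast (by omega : 0 < m)
  set u : ℝ := Real.pi / m with hu
  have hu0 : 0 < u := by positivity
  have hmu : (m : ℝ) * u = Real.pi := by rw [hu]; field_simp
  have hθ : ∀ j : ℕ, ang m j = 2 * j * u := by intro j; rw [ang, hu]; ring
  have hkl' : (k : ℝ) + 1 ≤ l := by exact_mod_cast hkl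
  have hl' : (l : ℝ) + 1 ≤ m := by exact_mod_cast hl
  have hk0 : (0 : ℝ) ≤ k := by positivity
  set μ : ℝ := (k + l) * u with hμ
  set δ : ℝ := (l - k) * u with hδ
  set ρ := α * Real.cos μ + β * Real.sin μ with hρ
  set τ := - α * Real.sin μ + β * Real.cos μ with hτ
  have hd0 : 0 < δ := by apply mul_pos _ hu0; linarith
  have hd1 : δ < Real.pi := by rw [← hmu]; apply mul_lt_mul_of_pos_right _ hu0; linarith
  have form : ∀ x, α * Real.cos (μ + x) + β * Real.sin (μ + x) = ρ * Real.cos x + τ * Real.sin x := by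
    intro x
    rw [Real.cos_add, Real.sin_add, hρ, hτ]; ring
  have ek : ang m k = μ + -δ := by rw [hθ, hμ, hδ]; ring
  have el : ang m l = μ + δ := by rw [hθ, hμ, hδ]; ring
  rw [ek, form, Real.cos_neg, Real.sin_neg] at hk1
  rw [el, form] at hl1
  have hs := Real.sin_pos_of_pos_of_lt_pi hd0 hd1
  have hτ0 : τ = 0 := by
    have : τ * Real.sin δ = 0 := by linarith
    rcases mul_eq_zero.1 this with h | h
    · exact h
    · linarith
  have form2 : ∀ x, α * Real.cos (μ + x) + β * Real.sin (μ + x) = ρ * Real.cos x := by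
    intro x; rw [form, hτ0]; ring
  have hC : C = ρ * Real.cos δ := by rw [← hl1, hτ0]; ring
  by_contra hcon
  push Not at hcon
  obtain ⟨c1, c2⟩ := hcon
  rcases lt_trichotomy ρ 0 with h | h | h
  · -- negative
    have hx : ∃ j < m, Real.cos (ang m j - μ) = Real.cos (δ + 2 * u) ∧ l - k + 2 ≤ m := by
      rcases Nat.eq_zero_or_pos k with hk | hk
      · refine ⟨l + 1, by have := c2 hk; omega, ?_, by have := c2 hk; omega⟩
        congr 1
        rw [hθ, hμ, hδ]; push_cast; ring
      · refine ⟨k - 1, by omega, ?_, by omega⟩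
        rw [← Real.cos_neg]
        congr 1
        rw [hθ, hμ, hδ, Nat.cast_sub (by omega)]; push_cast; ring
    obtain ⟨j, hj, e, hlk⟩ := hx
    have h1 := hle j hj
    have : ang m j = μ + (ang m j - μ) := by ring
    rw [this, form2, e, hC] at h1
    have h2 : Real.cos (δ + 2 * u) < Real.cos δ := by
      apply Real.cos_lt_cos_of_nonneg_of_le_pi hd0.le _ (by linarith)
      rw [hδ, ← hmu, ← add_mul]
      apply mul_le_mul_of_nonneg_right _ hu0.le
      have : (l : ℝ) + 2 ≤ m + k := by exact_mod_cast (by omega : l + 2 ≤ m + k)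
      linarith
    nlinarith
  · obtain ⟨j, hj, h1⟩ := hst
    have : ang m j = μ + (ang m j - μ) := by ring
    rw [this, form2, hC, h] at h1
    simp at h1
  · have h1 := hle (k + 1) (by omega)
    have : ang m (k + 1) = μ + -(δ - 2 * u) := by
      rw [hθ, hμ, hδ]; push_cast; ring
    rw [this, form2, hC, Real.cos_neg] at h1
    have hg : (k : ℝ) + 2 ≤ l := by exact_mod_cast (by omega : k + 2 ≤ l)
    have h2 : Real.cos δ < Real.cos (δ - 2 * u) := by
      apply Real.cos_lt_cos_of_nonneg_of_le_pi _ hd1.le (by linarith)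
      rw [hδ, ← sub_mul]
      apply mul_nonneg _ hu0.le
      linarith
    nlinarith

theorem max_side {m : ℕ} (hm : 3 ≤ m) {α β C : ℝ}
    (hle : ∀ j < m, α * Real.cos (ang m j) + β * Real.sin (ang m j) ≤ C)
    (hst : ∃ j < m, α * Real.cos (ang m j) + β * Real.sin (ang m j) < C) :
    ∃ i < m, ∀ j < m, α * Real.cos (ang m j) + β * Real.sin (ang m j) = C → j = i ∨ j = nx m i := by
  have adj : ∀ k l : ℕ, k < l → l < m → α * Real.cos (ang m k) + β * Real.sin (ang m k) = C →
    α * Real.cos (ang m l) + β * Real.sin (ang m l) = C → l = k + 1 ∨ (k = 0 ∧ l + 1 = m) :=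
    fun k l a b c d => max_adj hle hst a b c d
  set h : ℕ → ℝ := fun j => α * Real.cos (ang m j) + β * Real.sin (ang m j) with hh
  change ∃ i < m, ∀ j < m, h j = C → j = i ∨ j = nx m i
  have adj : ∀ k l : ℕ, k < l → l < m → h k = C → h l = C → l = k + 1 ∨ (k = 0 ∧ l + 1 = m) := adj
  by_cases h0 : h 0 = C ∧ h (m - 1) = C
  · refine ⟨m - 1, by omega, fun j hj hjC => ?_⟩
    by_contra hcon
    have hn : nx m (m - 1) = 0 := by unfold nx; split_ifs <;> omega
    rw [hn] at hcon
    have a1 := adj 0 j (by omega) hj h0.1 hjC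
    have a2 := adj j (m - 1) (by omega) (by omega) hjC h0.2
    have hm3 : m = 3 := by omega
    have hj1 : j = 1 := by omega
    subst hm3; subst hj1
    obtain ⟨i, hi, hlt⟩ := hst
    have hlt : h i < C := hlt
    interval_cases i
    · exact hlt.ne h0.1
    · exact hlt.ne hjC
    · exact hlt.ne h0.2
  · by_cases hex : ∃ k, k < m ∧ h k = C
    · obtain ⟨hk, hkC⟩ := Nat.find_spec hex
      have hmin := fun j => Nat.find_min' hex (m := j)
      set k := Nat.find hex
      refine ⟨k, hk, fun j hj hjC => ?_⟩
      have := hmin j ⟨hj, hjC⟩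
      by_cases e : j = k
      · exact Or.inl e
      · right
        rcases adj k j (by omega) hj hkC hjC with a | ⟨a, b⟩
        · unfold nx; split_ifs <;> omega
        · exfalso
          apply h0
          rw [← a]
          have : j = m - 1 := by omega
          rw [← this]
          exact ⟨hkC, hjC⟩
    · exact ⟨0, by omega, fun j hj hjC => (hex ⟨j, hj, hjC⟩).elim⟩

theorem std_complete {m : ℕ} (hm : 3 ≤ m) (S : Finset Pt3) (hS : S ⊆ stdBot m ∪ stdPrismTop m)
    (hne : S ≠ stdBot m ∪ stdPrismTop m)
    (hE : IsExtreme ℝ (cv ((stdBot m ∪ stdPrismTop m : Finset Pt3) : Set Pt3)) (cv (S : Set Pt3))) :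
    (∃ b, S ⊆ capF (stdP m) m b) ∨ ∃ i < m, S ⊆ sideF (stdP m) m i := by
  rcases S.eq_empty_or_nonempty with rfl | hSn
  · exact Or.inl ⟨true, by simp⟩
  obtain ⟨f, c, hf1, hf2, hf3⟩ := supp_face (convex_convexHull ℝ _) (std_int hm) hE (Finset.coe_nonempty.2 hSn)
    (fun hsub => hne (Finset.Subset.antisymm hS (fun x hx => Finset.mem_coe.1
      ((std_pts m).mem (Finset.coe_subset.2 hS) (Finset.mem_coe.2 hx)
        (hsub (subset_convexHull ℝ _ (Finset.mem_coe.2 hx)))))))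
  have hst : ∃ b, ∃ i < m, f (stdP m b i) < c := by
    by_contra hcon
    push Not at hcon
    obtain ⟨x, hx, hlt⟩ := hf2
    have := conv_ge (f := f) (c := c) (fun y hy => by
      obtain ⟨b, i, hi, rfl⟩ := mem_std.1 (Finset.mem_coe.1 hy)
      exact hcon b i hi) x hx
    linarith
  have hle : ∀ b, ∀ i < m, f (stdP m b i) ≤ c := fun b i hi =>
    hf1 _ (subset_convexHull ℝ _ (Finset.mem_coe.2 (mem_std.2 ⟨b, i, hi, rfl⟩)))
  obtain ⟨k, α, β, γ, hf⟩ := aff_form f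
  have hfs : ∀ b i, f (stdP m b i) = k + (α * Real.cos (ang m i) + β * Real.sin (ang m i) + γ * (if b then 1 else 0)) := by
    intro b i; rw [hf]; simp [stdP]
  rcases lt_trichotomy γ 0 with h | h | h
  · refine Or.inl ⟨false, fun x hx => ?_⟩
    obtain ⟨b, i, hi, rfl⟩ := mem_std.1 (hS hx)
    have h1 := hf3 _ (Finset.mem_coe.2 hx)
    have h2 := hle false i hi
    rw [hfs] at h1 h2
    cases b
    · exact Prism.mem_cap.2 ⟨i, hi, rfl⟩
    · simp at h1 h2; linarith
  · right
    obtain ⟨i, hi, hmax⟩ := max_side hm (α := α) (β := β) (C := c - k)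
      (fun j hj => by have := hle true j hj; rw [hfs, h] at this; linarith)
      (by obtain ⟨b, j, hj, hlt⟩ := hst; rw [hfs, h] at hlt; exact ⟨j, hj, by linarith⟩)
    refine ⟨i, hi, fun x hx => ?_⟩
    obtain ⟨b, j, hj, rfl⟩ := mem_std.1 (hS hx)
    have h1 := hf3 _ (Finset.mem_coe.2 hx)
    rw [hfs, h] at h1
    rcases hmax j hj (by linarith) with rfl | rfl <;> cases b <;> simp [sideF]
  · refine Or.inl ⟨true, fun x hx => ?_⟩
    obtain ⟨b, i, hi, rfl⟩ := mem_std.1 (hS hx)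
    have h1 := hf3 _ (Finset.mem_coe.2 hx)
    have h2 := hle true i hi
    rw [hfs] at h1 h2
    cases b
    · simp at h1 h2; linarith
    · exact Prism.mem_cap.2 ⟨i, hi, rfl⟩

theorem std_prism {m : ℕ} (hm : 3 ≤ m) : Prism m (stdBot m ∪ stdPrismTop m) (stdP m) where
  hm := hm
  inj := fun _ _ _ _ hi hj h => std_inj hi hj h
  V_eq := by rw [stdBot_eq, stdTop_eq]
  pts := std_pts m
  cap := std_cap
  side := fun _ hi => std_side hm hi
  complete := std_complete hm

theorem Prism.transfer {m : ℕ} {A V : Finset Pt3} {q : Bool → ℕ → Pt3} {ψ : Pt3 → Pt3} (P : Prism m A q)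
    (h : CombEquiv A V ψ) : Prism m V (fun b i => ψ (q b i)) := by
  obtain ⟨hb, hE⟩ := h
  have ecap : ∀ b, capF (fun b i => ψ (q b i)) m b = (capF q m b).image ψ := by
    intro b
    simp only [capF, Finset.image_image]
    rfl
  have eside : ∀ i, sideF (fun b i => ψ (q b i)) m i = (sideF q m i).image ψ := by
    intro i
    simp [sideF, Finset.image_insert]
  have eV : V = A.image ψ := by
    rw [← Finset.coe_inj, Finset.coe_image]; exact hb.image_eq.symm
  refine ⟨P.hm, ?_, ?_, ?_, ?_, ?_, ?_⟩
  · intro b b' i j hi hj e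
    exact P.inj b b' i j hi hj (hb.injOn (Finset.mem_coe.2 (P.p_mem b hi)) (Finset.mem_coe.2 (P.p_mem b' hj)) e)
  · rw [ecap, ecap, ← Finset.image_union, ← P.V_eq, eV]
  · intro x hx
    obtain ⟨a, ha, rfl⟩ := hb.surjOn hx
    have := (hE {a} (by simpa using ha)).1 (by rw [convexHull_singleton]; exact P.pts a ha)
    rwa [image_singleton, convexHull_singleton] at this
  · intro b
    have := (hE _ (Finset.coe_subset.2 (P.cap_sub b))).1 (P.cap b)
    rwa [← Finset.coe_image, ← ecap] at this
  · intro i hi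
    have := (hE _ (Finset.coe_subset.2 (P.side_sub hi))).1 (P.side i hi)
    rwa [← Finset.coe_image, ← eside] at this
  · intro S hS hne hSE
    set S0 := A.filter (fun a => ψ a ∈ S) with hS0
    have e0 : S = S0.image ψ := by
      ext x
      simp only [hS0, Finset.mem_image, Finset.mem_filter]
      constructor
      · intro hx
        have := hS hx
        rw [eV, Finset.mem_image] at this
        obtain ⟨a, ha, rfl⟩ := this
        exact ⟨a, ⟨ha, hx⟩, rfl⟩
      · rintro ⟨a, ⟨_, h⟩, rfl⟩; exact h
    have hsub : S0 ⊆ A := Finset.filter_subset _ _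
    have hE0 := (hE _ (Finset.coe_subset.2 hsub)).2 (by rw [← Finset.coe_image, ← e0]; exact hSE)
    rcases P.complete S0 hsub (fun e => hne (by rw [e0, e, ← eV])) hE0 with ⟨b, hb⟩ | ⟨i, hi, hb⟩
    · left; refine ⟨b, ?_⟩
      rw [e0, ecap]; exact Finset.image_subset_image hb
    · right; refine ⟨i, hi, ?_⟩
      rw [e0, eside]; exact Finset.image_subset_image hb


/-- every triangulation of a 3-dimensional `m`-prism (in any
coordinatization, i.e. any polytope combinatorially equivalent to the product of
a convex `m`-gon with a segment) has at least `2m - 5 + ⌈m/2⌉` tetrahedra, and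
this bound is attained: the minimal triangulation has size `2m - 5 + ⌈m/2⌉`. -/
theorem prism_minimal_triangulation (m : ℕ) (hm : 3 ≤ m)
    (V : Finset Pt3) (ψ : Pt3 → Pt3)
    (h : CombEquiv (stdBot m ∪ stdPrismTop m) V ψ) :
    (∀ T, IsTriangulation V T → 2 * m - 5 + (m + 1) / 2 ≤ T.card) ∧
    (∃ T, IsTriangulation V T ∧ T.card = 2 * m - 5 + (m + 1) / 2) := by
  have P := (std_prism hm).transfer h
  refine ⟨fun T hT => P.lower hT, ?_⟩
  obtain ⟨T, hT, hc⟩ := P.upper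
  exact ⟨T, hT, le_antisymm hc (P.lower hT)⟩
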